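/- arXiv:2012.12460 — 2 statements merged into one kernel-verified Lean document; each statement's English description precedes it below -/
import Mathlib

section
/- Let n > 4 and let H = C(n,n) be the set of all n-cycles in S_n. Let G = S_n if n is even and G = A_n if n is odd, and let Γ = Cay(G,H). Then λ1(Γ) = (n−1)!. Furthermore, λ2(Γ) = (n−2)! when n is even and λ2(Γ) = 2·(n−3)! when n is odd. -/
open Equiv

/-- The Cayley graph of a subset `H` of a group `G`: vertices are the elements of `G`,
with `u` adjacent to `v` iff `u * v⁻¹ ∈ H` (symmetrized; this agrees with the usual
definition when `H = H⁻¹`). -/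
def cayleyGraph {G : Type*} [Group G] (H : Set G) : SimpleGraph G :=
  SimpleGraph.fromRel (fun u v => u * v⁻¹ ∈ H)

/-- The set of (real) eigenvalues of a finite graph, i.e. the spectrum of its
adjacency matrix. -/
noncomputable def graphEigs {V : Type*} [Finite V] (Γ : SimpleGraph V) : Set ℝ := by
  classical
  letI : Fintype V := Fintype.ofFinite V
  exact spectrum ℝ (Γ.adjMatrix ℝ)

/-- The set of `n`-cycles, as a subset of `S_n`. -/
def fullCycles (n : ℕ) : Set (Perm (Fin n)) :=
  {g : Perm (Fin n) | g.IsCycle ∧ g.support.card = n}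

/-- The set of `n`-cycles, as a subset of `A_n`. -/
def fullCyclesAlt (n : ℕ) : Set (alternatingGroup (Fin n)) :=
  {g : alternatingGroup (Fin n) |
    (g : Perm (Fin n)).IsCycle ∧ (g : Perm (Fin n)).support.card = n}

/-- The list of the first `p` positive multiples of `ε`. -/
noncomputable def multiplesList (ε : ℝ) (p : ℕ) : List ℝ :=
  (List.range p).map fun i : ℕ => ε * ((i : ℝ) + 1)

theorem multiplesList_succ (ε : ℝ) (p : ℕ) :
    multiplesList ε (p + 1) = multiplesList ε p ++ [ε * (p + 1)] := by
  simp [multiplesList, List.range_succ]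

theorem multiplesList_prod (ε : ℝ) (p : ℕ) : (multiplesList ε p).prod = ε ^ p * p.factorial := by
  induction p with
  | zero => simp [multiplesList]
  | succ p ih => rw [multiplesList_succ, List.prod_append, ih]; simp [Nat.factorial_succ]; ring

/-- The combinatorial properties of the set of joint spectra of the Jucys–Murphy elements. -/
structure IsWeightSet (S : List ℝ → Prop) : Prop where
  head : ∀ x l, S (x :: l) → x = 0
  ne : ∀ l₁ x l₂, ¬ S (l₁ ++ x :: x :: l₂)
  swap : ∀ l₁ x y l₂, S (l₁ ++ x :: y :: l₂) → |x - y| ≠ 1 → S (l₁ ++ y :: x :: l₂)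
  braid : ∀ l₁ x y l₂, |x - y| = 1 → ¬ S (l₁ ++ x :: y :: x :: l₂)

namespace IsWeightSet

variable {S : List ℝ → Prop}

theorem move (hS : IsWeightSet S) (m : List ℝ) (l₁ : List ℝ) (x : ℝ) (l₂ : List ℝ)
    (h : S (l₁ ++ m ++ x :: l₂)) (hm : ∀ y ∈ m, |y - x| ≠ 1) : S (l₁ ++ x :: (m ++ l₂)) := by
  induction m generalizing l₁ with
  | nil => simpa using h
  | cons y m ih =>
    have := ih (l₁ ++ [y]) (by simpa using h) fun z hz => hm z (by simp [hz])
    have := hS.swap l₁ y x (m ++ l₂) (by simpa using this) (hm y (by simp))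
    simpa using this

theorem not_repeat (hS : IsWeightSet S) {ε : ℝ} (hε : |ε| = 1) {j p : ℕ} (hj : j < p)
    (l₁ l₂ : List ℝ) : ¬ S (l₁ ++ multiplesList ε p ++ (ε * (j + 1)) :: l₂) := by
  intro h
  obtain ⟨d, rfl⟩ := Nat.exists_eq_add_of_le (Nat.succ_le_of_lt hj)
  rcases d with _ | d
  · exact hS.ne (l₁ ++ multiplesList ε j) (ε * (j + 1)) l₂
      (by simpa [multiplesList_succ] using h)
  · have e : multiplesList ε (j.succ + (d + 1)) = multiplesList ε j ++ ε * (j + 1) ::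
        ε * (j + 2) :: (List.range d).map fun i : ℕ => ε * (j + i + 3) := by
      rw [multiplesList, List.range_add, List.range_succ, List.range_succ_eq_map]
      simp [multiplesList]
      exact ⟨Or.inl (by ring), fun i _ => Or.inl (by ring)⟩
    rw [e] at h
    have := hS.move ((List.range d).map fun i : ℕ => ε * (j + i + 3))
      (l₁ ++ multiplesList ε j ++ [ε * (j + 1), ε * (j + 2)]) (ε * (j + 1)) l₂
      (by simpa using h) (by
        simp only [List.mem_map, forall_exists_index, and_imp]
        rintro y i - rfl
        rw [← mul_sub, abs_mul, hε, one_mul]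
        have : (0 : ℝ) ≤ i := i.cast_nonneg
        rw [abs_of_nonneg (by linarith)]
        intro h; linarith)
    refine hS.braid (l₁ ++ multiplesList ε j) (ε * (j + 1)) (ε * (j + 2)) _ ?_
      (by simpa using this)
    rw [← mul_sub, abs_mul, hε, one_mul]
    norm_num

theorem exists_hook (hS : IsWeightSet S) (r : List ℝ) (hr : (0 : ℝ) ∉ r) (p q : ℕ)
    (h : S (0 :: (multiplesList 1 p ++ multiplesList (-1) q ++ r))) :
    ∃ p' q' : ℕ, p' + q' = p + q + r.length ∧
      (multiplesList 1 p ++ multiplesList (-1) q ++ r).prod =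
        (-1) ^ q' * p'.factorial * q'.factorial := by
  induction r generalizing p q with
  | nil => exact ⟨p, q, rfl, by simp [multiplesList_prod]; ring⟩
  | cons x r ih =>
    simp only [List.mem_cons, not_or] at hr
    obtain ⟨hx, hr⟩ := hr
    have hx : x ≠ 0 := fun h => hx h.symm
    by_cases hq : x = -1 * (q + 1)
    · obtain ⟨p', q', h1, h2⟩ := ih hr p (q + 1) (by
        rw [multiplesList_succ, ← hq]; simpa using h)
      refine ⟨p', q', by rw [h1]; simp; ring, ?_⟩
      rw [← h2, multiplesList_succ, ← hq]; simp
    by_cases hqj : ∃ j < q, x = -1 * ((j : ℝ) + 1)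
    · obtain ⟨j, hj, rfl⟩ := hqj
      exact absurd (by simpa using h)
        (hS.not_repeat (ε := -1) (by simp) hj (0 :: multiplesList 1 p) r)
    push Not at hqj
    have hmove : S (0 :: multiplesList 1 p ++ x :: (multiplesList (-1) q ++ r)) := by
      refine hS.move _ _ _ _ (by simpa using h) ?_
      simp only [multiplesList, List.mem_map, List.mem_range, forall_exists_index, and_imp]
      rintro y i hi rfl h1
      rcases eq_or_eq_neg_of_abs_eq h1 with h1 | h1
      · rcases (Nat.succ_le_of_lt hi).eq_or_lt with h2 | h2
        · apply hq; rw [← h2]; push_cast; linarith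
        · apply hqj _ h2; push_cast; linarith
      · rcases i with _ | i
        · apply hx; push_cast at h1; linarith
        · apply hqj i (by omega); push_cast at h1; linarith
    by_cases hp : x = 1 * (p + 1)
    · obtain ⟨p', q', h1, h2⟩ := ih hr (p + 1) q (by
        rw [multiplesList_succ, ← hp]; simpa using hmove)
      refine ⟨p', q', by rw [h1]; simp; ring, ?_⟩
      rw [← h2, multiplesList_succ, ← hp]
      simp only [List.prod_append, List.prod_cons, List.prod_nil]; ring
    by_cases hpj : ∃ j < p, x = 1 * ((j : ℝ) + 1)
    · obtain ⟨j, hj, rfl⟩ := hpj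
      exact absurd (by simpa using hmove)
        (hS.not_repeat (ε := 1) (by simp) hj [0] (multiplesList (-1) q ++ r))
    push Not at hpj
    have hzero : |0 - x| ≠ 1 := by
      intro h1
      rcases eq_or_eq_neg_of_abs_eq h1 with h1 | h1
      · rcases q with _ | q
        · apply hq; push_cast; linarith
        · apply hqj 0 (by omega); push_cast; linarith
      · rcases p with _ | p
        · apply hp; push_cast; linarith
        · apply hpj 0 (by omega); push_cast; linarith
    refine absurd (hS.head _ _ (hS.move (0 :: multiplesList 1 p) [] x _ (by simpa using hmove) ?_)) hx
    simp only [multiplesList, List.mem_cons, List.mem_map, List.mem_range]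
    rintro y (rfl | ⟨i, hi, rfl⟩) h1
    · exact hzero h1
    rcases eq_or_eq_neg_of_abs_eq h1 with h1 | h1
    · rcases i with _ | i
      · apply hx; push_cast at h1; linarith
      · apply hpj i (by omega); push_cast at h1; linarith
    · rcases (Nat.succ_le_of_lt hi).eq_or_lt with h2 | h2
      · apply hp; rw [← h2]; push_cast; linarith
      · apply hpj _ h2; push_cast; linarith

theorem tail_prod (hS : IsWeightSet S) {x : ℝ} {r : List ℝ} (h : S (x :: r)) (hr : (0 : ℝ) ∉ r) :
    ∃ p q : ℕ, p + q = r.length ∧ r.prod = (-1) ^ q * p.factorial * q.factorial := by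
  obtain rfl := hS.head _ _ h
  simpa [multiplesList] using hS.exists_hook r hr 0 0 (by simpa [multiplesList] using h)

end IsWeightSet

/-- The joint spectra, listed in order, of the operators `K 0, …, K (n - 1)`. -/
def JointSpectrum {V : Type*} [AddCommGroup V] [Module ℝ V] (K : ℕ → Module.End ℝ V) (n : ℕ)
    (l : List ℝ) : Prop :=
  l.length = n ∧ ∃ v ≠ 0, ∀ k x, l[k]? = some x → K k v = x • v

/-- Symmetric operators satisfying the relations between the Jucys–Murphy elements `K i` and the
adjacent transpositions `s i`. -/
structure JucysMurphyRelations {V : Type*} [NormedAddCommGroup V] [InnerProductSpace ℝ V]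
    (K s : ℕ → Module.End ℝ V) (n : ℕ) : Prop where
  zero : 0 < n → K 0 = 0
  symm_K : ∀ i, (K i).IsSymmetric
  symm_s : ∀ i, i + 1 < n → (s i).IsSymmetric
  sq : ∀ i, i + 1 < n → s i * s i = 1
  braid : ∀ i, i + 2 < n → s i * s (i + 1) * s i = s (i + 1) * s i * s (i + 1)
  rel : ∀ i, i + 1 < n → K (i + 1) * s i = s i * K i + 1
  comm : ∀ i j, i + 1 < n → j < n → j ≠ i → j ≠ i + 1 → Commute (s i) (K j)

namespace JucysMurphyRelations

variable {V : Type*} [NormedAddCommGroup V] [InnerProductSpace ℝ V]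
  {K s : ℕ → Module.End ℝ V} {n : ℕ}

theorem rel' (h : JucysMurphyRelations K s n) {i : ℕ} (hi : i + 1 < n) :
    K i * s i = s i * K (i + 1) - 1 := by
  have h1 := congrArg (fun A => s i * A * s i) (h.rel i hi)
  simp only [mul_add, add_mul, mul_assoc, h.sq i hi, mul_one] at h1
  rw [← mul_assoc (s i) (s i), h.sq i hi, one_mul] at h1
  rw [h1]; simp

/-- The basic dichotomy for an adjacent pair of eigenvalues. -/
theorem local_analysis (h : JucysMurphyRelations K s n) {i : ℕ} (hi : i + 1 < n) {v : V}
    (hv : v ≠ 0) {a b : ℝ} (ha : K i v = a • v) (hb : K (i + 1) v = b • v) :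
    a ≠ b ∧ (|a - b| = 1 → s i v = (b - a) • v) ∧
      (|a - b| ≠ 1 → s i v - (b - a)⁻¹ • v ≠ 0) ∧
      K i (s i v - (b - a)⁻¹ • v) = b • (s i v - (b - a)⁻¹ • v) ∧
      K (i + 1) (s i v - (b - a)⁻¹ • v) = a • (s i v - (b - a)⁻¹ • v) := by
  have e1 : K i (s i v) = b • s i v - v := by
    have := congrArg (fun A => A v) (h.rel' hi)
    simpa [hb] using this
  have e2 : K (i + 1) (s i v) = a • s i v + v := by
    have := congrArg (fun A => A v) (h.rel i hi)
    simpa [ha] using this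
  have hss : ∀ w, s i (s i w) = w := fun w => by
    simpa using congrArg (fun A => A w) (h.sq i hi)
  have hvv : inner ℝ v v ≠ (0 : ℝ) := inner_self_ne_zero.mpr hv
  have hab : a ≠ b := by
    rintro rfl
    have := h.symm_K i (s i v) v
    rw [e1, ha, inner_sub_left, inner_smul_left, inner_smul_right] at this
    simp at this
    exact hv this
  have hba : b - a ≠ 0 := sub_ne_zero.mpr hab.symm
  set c := (b - a)⁻¹ with hc
  have hcc : c * (b - a) = 1 := inv_mul_cancel₀ hba
  have k1 : K i (s i v - c • v) = b • (s i v - c • v) := by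
    rw [map_sub, map_smul, e1, ha]
    have : v = (c * (b - a)) • v := by rw [hcc, one_smul]
    nth_rw 2 [this]
    module
  have k2 : K (i + 1) (s i v - c • v) = a • (s i v - c • v) := by
    rw [map_sub, map_smul, e2, hb]
    have : v = (c * (b - a)) • v := by rw [hcc, one_smul]
    nth_rw 2 [this]
    module
  have orth : inner ℝ v (s i v) = c * inner ℝ v v := by
    have := h.symm_K i (s i v - c • v) v
    rw [k1, ha, inner_smul_left, inner_smul_right] at this
    have h0 : (b - a) * inner ℝ (s i v - c • v) v = 0 := by
      simp only [conj_trivial] at this; linarith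
    have h0 := (mul_eq_zero.mp h0).resolve_left hba
    rw [inner_sub_left, inner_smul_left, real_inner_comm] at h0
    simp only [conj_trivial] at h0; linarith
  have nrm : inner ℝ (s i v - c • v) (s i v - c • v) = (1 - c ^ 2) * inner ℝ v v := by
    have hs : inner ℝ (s i v) (s i v) = inner ℝ v v := by rw [h.symm_s i hi, hss]
    simp only [inner_sub_left, inner_sub_right, inner_smul_left, inner_smul_right, hs,
      real_inner_comm v (s i v), orth, conj_trivial]
    ring
  refine ⟨hab, fun h1 => ?_, fun h1 h2 => h1 ?_, k1, k2⟩
  · have h2 : (b - a) ^ 2 = 1 := by rw [← sq_abs, abs_sub_comm, h1, one_pow]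
    have h3 : c = b - a := by
      rw [hc]; exact inv_eq_of_mul_eq_one_left (by rw [← h2]; ring)
    have : inner ℝ (s i v - c • v) (s i v - c • v) = (0 : ℝ) := by rw [nrm, h3, h2]; simp
    rw [← h3]
    exact sub_eq_zero.mp (inner_self_eq_zero.mp this)
  · rw [h2, inner_zero_left] at nrm
    have h3 : c ^ 2 = 1 := by
      have := (mul_eq_zero.mp nrm.symm).resolve_right hvv
      linarith
    have h4 : (b - a) ^ 2 = 1 := by
      have : (c * (b - a)) ^ 2 = 1 := by rw [hcc, one_pow]
      rwa [mul_pow, h3, one_mul] at this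
    rw [abs_sub_comm]
    exact (pow_eq_one_iff_of_nonneg (abs_nonneg _) two_ne_zero).mp (by rw [sq_abs, h4])

theorem isWeightSet (h : JucysMurphyRelations K s n) : IsWeightSet (JointSpectrum K n) where
  head x l := by
    rintro ⟨hl, v, hv, hk⟩
    have := hk 0 x (by simp)
    rw [h.zero (by simp at hl; omega)] at this
    exact (smul_eq_zero.mp (by simpa using this.symm)).resolve_right hv
  ne l₁ x l₂ := by
    rintro ⟨hl, v, hv, hk⟩
    simp at hl
    exact (h.local_analysis (i := l₁.length) (by omega) hv (hk _ x (by simp))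
      (hk _ x (by simp))).1 rfl
  swap l₁ x y l₂ := by
    rintro ⟨hl, v, hv, hk⟩ hxy
    simp at hl
    have hi : l₁.length + 1 < n := by omega
    obtain ⟨-, -, h1, h2, h3⟩ := h.local_analysis hi hv (hk _ x (by simp))
      (hk _ y (by simp))
    refine ⟨by simp; omega, _, h1 hxy, fun k z hz => ?_⟩
    by_cases hk1 : k = l₁.length
    · subst hk1
      obtain rfl : y = z := by simpa using hz
      exact h2
    by_cases hk2 : k = l₁.length + 1
    · subst hk2
      obtain rfl : x = z := by simpa using hz
      exact h3
    have hz' : (l₁ ++ x :: y :: l₂)[k]? = some z := by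
      rw [← hz]
      rcases lt_or_ge k l₁.length with hlt | hge
      · rw [List.getElem?_append_left hlt, List.getElem?_append_left hlt]
      · rw [List.getElem?_append_right hge, List.getElem?_append_right hge]
        obtain ⟨d, hd⟩ : ∃ d, k - l₁.length = d + 2 := ⟨k - l₁.length - 2, by omega⟩
        rw [hd]; rfl
    have hkn : k < n := by
      have := (List.getElem?_eq_some_iff.mp hz').1
      simp at this; omega
    have hc := congrArg (fun A => A v) (h.comm _ k hi hkn hk1 hk2).eq
    rw [Module.End.mul_apply, Module.End.mul_apply] at hc
    rw [map_sub, map_smul, ← hc, hk k z hz', map_smul]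
    module
  braid l₁ x y l₂ hxy := by
    rintro ⟨hl, v, hv, hk⟩
    simp at hl
    have h1 := (h.local_analysis (i := l₁.length) (by omega) hv (hk _ x (by simp))
      (hk _ y (by simp))).2.1 hxy
    have h2 := (h.local_analysis (i := l₁.length + 1) (by omega) hv (hk _ y (by simp))
      (hk (l₁.length + 1 + 1) x (by simp [add_assoc]))).2.1 (by rwa [abs_sub_comm])
    have h3 := congrArg (fun A => A v) (h.braid l₁.length (by omega))
    simp only [Module.End.mul_apply, h1, h2, map_smul, smul_smul] at h3
    have h4 := smul_left_injective ℝ hv h3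
    have h5 : y - x = 0 := by
      have : (y - x) ^ 2 = 1 := by rw [← sq_abs, abs_sub_comm, hxy, one_pow]
      linear_combination -(1/2) * h4 - (y - x) * this
    rw [← neg_sub, h5] at hxy
    simp at hxy

end JucysMurphyRelations

section JucysMurphy

variable {R : Type*} [Ring R] {n : ℕ}

/-- The image in `R` of the Jucys–Murphy element `∑_{t > k} (k t)` of the symmetric group. -/
def jucysMurphy (ρ : Perm (Fin n) →* R) (k : Fin n) : R :=
  ∑ t ∈ Finset.Ioi k, ρ (swap k t)

theorem commute_jucysMurphy (ρ : Perm (Fin n) →* R) {g : Perm (Fin n)} {k : Fin n} (hk : g k = k)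
    (hg : ∀ t, k < g t ↔ k < t) : Commute (ρ g) (jucysMurphy ρ k) := by
  rw [Commute, SemiconjBy, jucysMurphy, Finset.mul_sum, Finset.sum_mul]
  refine Finset.sum_equiv g (by simp [hg]) fun t _ => ?_
  rw [← map_mul, ← map_mul, Equiv.mul_swap_eq_swap_mul, hk]

theorem commute_jucysMurphy_of_lt (ρ : Perm (Fin n) →* R) {i j : Fin n} (hij : i < j) :
    Commute (jucysMurphy ρ j) (jucysMurphy ρ i) := by
  rw [jucysMurphy]
  refine Commute.sum_left _ _ _ fun t ht => commute_jucysMurphy ρ ?_ fun u => ?_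
  · rw [Finset.mem_Ioi] at ht
    exact swap_apply_of_ne_of_ne hij.ne (hij.trans ht).ne
  · rw [Finset.mem_Ioi] at ht
    rw [swap_apply_def]
    split_ifs with h1 h2
    · simp [h1, hij, hij.trans ht]
    · simp [h2, hij, hij.trans ht]
    · rfl

theorem jucysMurphy_mul_swap (ρ : Perm (Fin n) →* R) {a b : Fin n} (hab : (a : ℕ) + 1 = b) :
    jucysMurphy ρ a * ρ (swap a b) = ρ (swap a b) * jucysMurphy ρ b + 1 := by
  have h : Finset.Ioi a = insert b (Finset.Ioi b) := by
    ext t; simp only [Finset.mem_Ioi, Finset.mem_insert, Fin.lt_def, Fin.ext_iff]; omega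
  rw [jucysMurphy, h, Finset.sum_insert (by simp), add_mul, ← map_mul, swap_mul_self, map_one,
    add_comm, jucysMurphy, Finset.mul_sum, Finset.sum_mul]
  congr 1
  refine Finset.sum_congr rfl fun t ht => ?_
  have hbt : b < t := by simpa using ht
  have hat : a < t := lt_trans (by rw [Fin.lt_def]; omega) hbt
  rw [← map_mul, ← map_mul, Equiv.mul_swap_eq_swap_mul (swap a b) b t, swap_apply_right,
    swap_apply_of_ne_of_ne hat.ne' hbt.ne']

/-- The embedding of `S_n` in `S_{n+1}` as the stabilizer of `0`. -/
def permSucc (n : ℕ) : Perm (Fin n) →* Perm (Fin (n + 1)) where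
  toFun e := Perm.decomposeFin.symm (0, e)
  map_one' := by simp; rfl
  map_mul' e f := by
    ext x
    refine Fin.cases ?_ (fun x => ?_) x <;> simp

theorem decomposeFin_symm_eq (p : Fin (n + 1)) (e : Perm (Fin n)) :
    Perm.decomposeFin.symm (p, e) = swap 0 p * permSucc n e := by
  ext x
  refine Fin.cases ?_ (fun x => ?_) x <;> simp [permSucc]

theorem permSucc_swap (i j : Fin n) : permSucc n (swap i j) = swap i.succ j.succ := by
  ext x
  refine Fin.cases ?_ (fun x => ?_) x
  · simp [permSucc, swap_apply_of_ne_of_ne (Fin.succ_ne_zero i).symm (Fin.succ_ne_zero j).symm]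
  · simp [permSucc, (Fin.succ_injective n).swap_apply]

theorem jucysMurphy_succ (ρ : Perm (Fin (n + 1)) →* R) (k : Fin n) :
    jucysMurphy ρ k.succ = jucysMurphy (ρ.comp (permSucc n)) k := by
  rw [jucysMurphy, jucysMurphy, ← Fin.map_succEmb_Ioi, Finset.sum_map]
  simp [permSucc_swap]

theorem sameCycle_decomposeFin_iff (p : Fin (n + 2)) (e : Perm (Fin (n + 1))) :
    (∀ x y, (Perm.decomposeFin.symm (p, e)).SameCycle x y) ↔ p ≠ 0 ∧ ∀ x y, e.SameCycle x y := by
  set σ := Perm.decomposeFin.symm (p, e) with hσ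
  have h0 : σ 0 = p := by simp [hσ]
  have hs : ∀ x : Fin (n + 1), σ x.succ = swap 0 p (e x).succ := by simp [hσ]
  constructor
  · intro h
    have hp : p ≠ 0 := by
      rintro rfl
      obtain ⟨i, hi⟩ := h 0 1
      rw [Perm.zpow_apply_eq_self_of_apply_eq_self h0] at hi
      exact absurd hi (by simp)
    refine ⟨hp, fun x y => ?_⟩
    obtain ⟨q, rfl⟩ := Fin.exists_succ_eq.mpr hp
    have step : ∀ x : Fin (n + 2), e.SameCycle (Fin.cases q id x) (Fin.cases q id (σ x)) := by
      intro x
      refine Fin.cases ?_ (fun x => ?_) x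
      · rw [h0]; exact Perm.SameCycle.refl _ _
      · rw [hs]
        by_cases hq : e x = q
        · rw [hq, swap_apply_right]
          simp [← hq, Perm.SameCycle.refl]
        · rw [swap_apply_of_ne_of_ne (Fin.succ_ne_zero _) (by simpa using hq)]
          simp [Perm.SameCycle.refl]
    have pow : ∀ (k : ℕ) (x : Fin (n + 2)),
        e.SameCycle (Fin.cases q id x) (Fin.cases q id ((σ ^ k) x)) := by
      intro k
      induction k with
      | zero => intro x; exact Perm.SameCycle.refl _ _
      | succ k ih => intro x; rw [pow_succ', Perm.mul_apply]; exact (ih x).trans (step _)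
    obtain ⟨k, -, hk⟩ := (h x.succ y.succ).exists_pow_eq'
    have := pow k x.succ
    rw [hk] at this
    simpa using this
  · rintro ⟨hp, h⟩
    have step : ∀ x : Fin (n + 1), σ.SameCycle x.succ (e x).succ := by
      intro x
      by_cases hq : (e x).succ = p
      · refine ⟨2, ?_⟩
        have : σ x.succ = 0 := by rw [hs, hq, swap_apply_right]
        rw [zpow_two, Perm.mul_apply, this, h0, hq]
      · refine ⟨1, ?_⟩
        rw [zpow_one, hs, swap_apply_of_ne_of_ne (Fin.succ_ne_zero _) hq]
    have pow : ∀ (k : ℕ) (x : Fin (n + 1)), σ.SameCycle x.succ ((e ^ k) x).succ := by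
      intro k
      induction k with
      | zero => intro x; exact Perm.SameCycle.refl _ _
      | succ k ih => intro x; rw [pow_succ', Perm.mul_apply]; exact (ih x).trans (step _)
    have succ : ∀ x y : Fin (n + 1), σ.SameCycle x.succ y.succ := by
      intro x y
      obtain ⟨k, -, hk⟩ := (h x y).exists_pow_eq'
      have := pow k x
      rwa [hk] at this
    obtain ⟨q, rfl⟩ := Fin.exists_succ_eq.mpr hp
    have zero : ∀ x, σ.SameCycle q.succ x := by
      intro x
      refine Fin.cases ?_ (fun x => succ q x) x
      exact Perm.SameCycle.symm ⟨1, by simpa using h0⟩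
    exact fun x y => (zero x).symm.trans (zero y)

open Classical in
/-- The sum of the transitive cyclic permutations is a product of Jucys–Murphy elements. -/
theorem sum_sameCycle_eq_prod (m : ℕ) (ρ : Perm (Fin (m + 1)) →* R) :
    ∑ σ : Perm (Fin (m + 1)) with ∀ x y, σ.SameCycle x y, ρ σ =
      (List.ofFn fun k : Fin m => jucysMurphy ρ k.castSucc).prod := by
  induction m with
  | zero =>
    rw [Finset.filter_true_of_mem fun σ _ x y => by
      obtain rfl : x = y := Fin.ext (by omega)
      exact Perm.SameCycle.refl _ _]
    simp
  | succ m ih =>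
    rw [List.ofFn_succ, List.prod_cons]
    simp only [← Fin.succ_castSucc, jucysMurphy_succ, Fin.castSucc_zero]
    rw [← ih, jucysMurphy, Finset.sum_mul_sum, ← Finset.sum_product']
    symm
    refine Finset.sum_equiv Perm.decomposeFin.symm ?_ ?_
    · rintro ⟨p, e⟩
      simp [sameCycle_decomposeFin_iff]
    · rintro ⟨p, e⟩ -
      rw [decomposeFin_symm_eq, map_mul]; rfl

end JucysMurphy

section Spectrum

open Classical in
/-- The image of the sum of the transitive cyclic permutations. -/
noncomputable def cycleSum {R : Type*} [Ring R] {n : ℕ} (ρ : Perm (Fin n) →* R) : R :=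
  ∑ σ : Perm (Fin n) with ∀ x y, σ.SameCycle x y, ρ σ

theorem list_prod_apply {V : Type*} [AddCommGroup V] [Module ℝ V] {m : ℕ}
    (A : Fin m → Module.End ℝ V) (a : Fin m → ℝ) (v : V) (h : ∀ k, A k v = a k • v) :
    (List.ofFn A).prod v = (∏ k, a k) • v := by
  induction m with
  | zero => simp
  | succ m ih =>
    rw [List.ofFn_succ, List.prod_cons, Module.End.mul_apply,
      ih (fun k => A k.succ) (fun k => a k.succ) (fun k => h _), map_smul, h, smul_smul,
      Fin.prod_univ_succ, mul_comm]

theorem cycleSum_apply {V : Type*} [AddCommGroup V] [Module ℝ V] {m : ℕ}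
    (ρ : Perm (Fin (m + 1)) →* Module.End ℝ V) (a : Fin (m + 1) → ℝ) (v : V)
    (h : ∀ k, jucysMurphy ρ k v = a k • v) :
    cycleSum ρ v = (∏ k : Fin m, a k.castSucc) • v := by
  rw [cycleSum, sum_sameCycle_eq_prod]
  exact list_prod_apply _ _ _ fun k => h _

variable {V : Type*} [NormedAddCommGroup V] [InnerProductSpace ℝ V]

theorem isSymmetric_swap {n : ℕ} {ρ : Perm (Fin n) →* Module.End ℝ V}
    (hρ : ∀ g v w, inner ℝ (ρ g v) w = inner ℝ v (ρ g⁻¹ w)) (i j : Fin n) :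
    (ρ (swap i j)).IsSymmetric := fun v w => by
  rw [hρ, swap_inv]

theorem isSymmetric_jucysMurphy {n : ℕ} {ρ : Perm (Fin n) →* Module.End ℝ V}
    (hρ : ∀ g v w, inner ℝ (ρ g v) w = inner ℝ v (ρ g⁻¹ w)) (k : Fin n) :
    (jucysMurphy ρ k).IsSymmetric := fun v w => by
  simp only [jucysMurphy, LinearMap.sum_apply, sum_inner, inner_sum]
  exact Finset.sum_congr rfl fun t _ => isSymmetric_swap hρ k t v w

theorem isSymmetric_cycleSum {n : ℕ} {ρ : Perm (Fin n) →* Module.End ℝ V}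
    (hρ : ∀ g v w, inner ℝ (ρ g v) w = inner ℝ v (ρ g⁻¹ w)) :
    (cycleSum ρ).IsSymmetric := fun v w => by
  simp only [cycleSum, LinearMap.sum_apply, sum_inner, inner_sum]
  refine Finset.sum_equiv (Equiv.inv _) ?_ fun g _ => hρ g v w
  simp [Perm.sameCycle_inv]

theorem jucysMurphyRelations {n : ℕ} {ρ : Perm (Fin n) →* Module.End ℝ V}
    (hρ : ∀ g v w, inner ℝ (ρ g v) w = inner ℝ v (ρ g⁻¹ w)) :
    JucysMurphyRelations
      (fun k => if h : k < n then jucysMurphy ρ (Fin.rev ⟨k, h⟩) else 0)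
      (fun i => if h : i + 1 < n then
        ρ (swap (Fin.rev ⟨i + 1, h⟩) (Fin.rev ⟨i, by omega⟩)) else 0) n where
  zero hn := by
    rw [dif_pos hn, jucysMurphy, Finset.sum_eq_zero]
    intro t ht
    rw [Finset.mem_Ioi, Fin.lt_def, Fin.val_rev] at ht
    simp at ht; omega
  symm_K i := by
    split_ifs
    · exact isSymmetric_jucysMurphy hρ _
    · exact LinearMap.IsSymmetric.zero
  symm_s i hi := by
    rw [dif_pos hi]; exact isSymmetric_swap hρ _ _
  sq i hi := by
    rw [dif_pos hi, ← map_mul, swap_mul_self, map_one]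
  braid i hi := by
    rw [dif_pos (by omega), dif_pos (by omega)]
    simp only [← map_mul]
    congr 1
    have h1 : Fin.rev ⟨i, by omega⟩ ≠ (Fin.rev ⟨i + 1, by omega⟩ : Fin n) := by simp
    have h2 : Fin.rev ⟨i + 1, by omega⟩ ≠ (Fin.rev ⟨i + 1 + 1, by omega⟩ : Fin n) := by simp
    have h3 : Fin.rev ⟨i, by omega⟩ ≠ (Fin.rev ⟨i + 1 + 1, by omega⟩ : Fin n) := by
      simp only [ne_eq, Fin.ext_iff, Fin.val_rev]; omega
    rw [swap_comm (Fin.rev ⟨i + 1 + 1, _⟩), swap_comm (Fin.rev ⟨i + 1, _⟩) (Fin.rev ⟨i, _⟩),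
      swap_mul_swap_mul_swap h1 h3, swap_comm (Fin.rev ⟨i, _⟩) (Fin.rev ⟨i + 1, _⟩),
      swap_comm (Fin.rev ⟨i + 1, _⟩) (Fin.rev ⟨i + 1 + 1, _⟩),
      swap_mul_swap_mul_swap h2.symm h3.symm, swap_comm]
  rel i hi := by
    rw [dif_pos hi, dif_pos hi, dif_pos (by omega)]
    exact jucysMurphy_mul_swap ρ (by simp [Fin.val_rev]; omega)
  comm i j hi hj h1 h2 := by
    rw [dif_pos hi, dif_pos hj]
    refine commute_jucysMurphy ρ (swap_apply_of_ne_of_ne (by simpa) (by simpa)) fun t => ?_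
    rw [swap_apply_def]
    split_ifs with h3 h4
    · rw [h3]; simp only [Fin.lt_def, Fin.val_rev]; omega
    · rw [h4]; simp only [Fin.lt_def, Fin.val_rev]; omega
    · rfl

theorem exists_joint_eigenvector [FiniteDimensional ℝ V] {ι : Type*} {T : ι → Module.End ℝ V}
    (hT : ∀ i, (T i).IsSymmetric) (hcomm : Pairwise (Function.onFun Commute T))
    {A : Module.End ℝ V} (hA : A.IsSymmetric) (f : (ι → ℝ) → ℝ)
    (hf : ∀ χ w, (∀ i, T i w = χ i • w) → A w = f χ • w)
    {v : V} (hv : v ≠ 0) {μ : ℝ} (hμ : A v = μ • v) :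
    ∃ χ, f χ = μ ∧ ∃ w ≠ 0, ∀ i, T i w = χ i • w := by
  by_contra! hcon
  have key : (⊤ : Submodule ℝ V) ≤ (Submodule.span ℝ {v})ᗮ := by
    rw [← LinearMap.IsSymmetric.iSup_iInf_eq_top_of_commute hT hcomm]
    refine iSup_le fun χ w hw => ?_
    have hw : ∀ i, T i w = χ i • w := by
      simpa [Submodule.mem_iInf, Module.End.mem_eigenspace_iff] using hw
    rw [Submodule.mem_orthogonal_singleton_iff_inner_right]
    by_cases hχ : f χ = μ
    · by_cases hw0 : w = 0
      · simp [hw0]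
      · obtain ⟨i, hi⟩ := hcon χ hχ w hw0
        exact absurd (hw i) hi
    · have := hA v w
      rw [hμ, hf χ w hw, inner_smul_left, inner_smul_right] at this
      simp only [conj_trivial] at this
      exact (mul_eq_zero.mp (show (f χ - μ) * inner ℝ v w = 0 by linarith)).resolve_left
        (sub_ne_zero.mpr hχ)
  have := (Submodule.mem_orthogonal_singleton_iff_inner_right.mp (key (Submodule.mem_top (x := v))))
  exact hv (inner_self_eq_zero.mp this)

theorem eigenvalue_cycleSum [FiniteDimensional ℝ V] {m : ℕ}
    {ρ : Perm (Fin (m + 1)) →* Module.End ℝ V}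
    (hρ : ∀ g v w, inner ℝ (ρ g v) w = inner ℝ v (ρ g⁻¹ w)) {v : V} (hv : v ≠ 0) {μ : ℝ}
    (hμ : cycleSum ρ v = μ • v) :
    μ = 0 ∨ ∃ p q : ℕ, p + q = m ∧ μ = (-1) ^ q * p.factorial * q.factorial := by
  have hcomm : Pairwise (Function.onFun Commute (jucysMurphy ρ)) := by
    intro i j hij
    rcases lt_or_gt_of_ne hij with h | h
    · exact (commute_jucysMurphy_of_lt ρ h).symm
    · exact commute_jucysMurphy_of_lt ρ h
  obtain ⟨χ, rfl, w, hw, hχ⟩ := exists_joint_eigenvector (isSymmetric_jucysMurphy hρ) hcomm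
    (isSymmetric_cycleSum hρ) (fun χ => ∏ k : Fin m, χ k.castSucc)
    (fun χ w h => cycleSum_apply ρ χ w h) hv hμ
  set r := List.ofFn fun k : Fin m => χ (Fin.rev k).castSucc with hr
  have hprod : r.prod = ∏ k : Fin m, χ k.castSucc := by
    rw [hr, List.prod_ofFn]
    exact Equiv.prod_comp Fin.revPerm fun k : Fin m => χ k.castSucc
  have hS := (jucysMurphyRelations hρ).isWeightSet
  have hmem : JointSpectrum (fun k => if h : k < m + 1 then jucysMurphy ρ (Fin.rev ⟨k, h⟩) else 0)
      (m + 1) (χ (Fin.rev 0) :: r) := by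
    have : χ (Fin.rev 0) :: r = List.ofFn fun k => χ (Fin.rev k) := by
      rw [List.ofFn_succ]; simp only [hr, Fin.rev_succ]
    rw [this]
    refine ⟨by simp, w, hw, fun k x hx => ?_⟩
    obtain ⟨hk, rfl⟩ := List.getElem?_eq_some_iff.mp hx
    rw [List.length_ofFn] at hk
    simp only [dif_pos hk, List.getElem_ofFn]
    exact hχ _
  by_cases h0 : (0 : ℝ) ∈ r
  · left; rw [← hprod]; exact List.prod_eq_zero h0
  · right
    obtain ⟨p, q, hpq, h⟩ := hS.tail_prod hmem h0
    exact ⟨p, q, by simpa [hr] using hpq, by rw [← h, hprod]⟩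

end Spectrum

section RegularRepresentation

/-- The action of `S_n` on functions on `S_n` by left translation. -/
noncomputable def leftTranslation (n : ℕ) :
    Perm (Fin n) →* Module.End ℝ (EuclideanSpace ℝ (Perm (Fin n))) where
  toFun g :=
    { toFun := fun v => WithLp.toLp 2 fun σ => v (g⁻¹ * σ)
      map_add' := fun v w => by ext; simp
      map_smul' := fun c v => by ext; simp }
  map_one' := by ext; simp
  map_mul' g h := by ext; simp [mul_assoc]

theorem leftTranslation_apply {n : ℕ} (g σ : Perm (Fin n)) (v : EuclideanSpace ℝ (Perm (Fin n))) :
    leftTranslation n g v σ = v (g⁻¹ * σ) := rfl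

theorem inner_leftTranslation {n : ℕ} (g : Perm (Fin n))
    (v w : EuclideanSpace ℝ (Perm (Fin n))) :
    inner ℝ (leftTranslation n g v) w = inner ℝ v (leftTranslation n g⁻¹ w) := by
  simp only [PiLp.inner_apply, leftTranslation_apply, inv_inv]
  exact Fintype.sum_equiv (Equiv.mulLeft g⁻¹) _ _ fun σ => by simp

theorem jucysMurphy_leftTranslation_apply {n : ℕ} (k : Fin n) (σ : Perm (Fin n))
    (v : EuclideanSpace ℝ (Perm (Fin n))) :
    jucysMurphy (leftTranslation n) k v σ = ∑ t ∈ Finset.Ioi k, v (swap k t * σ) := by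
  simp [jucysMurphy, LinearMap.sum_apply, leftTranslation_apply]

open Classical in
theorem cycleSum_leftTranslation_apply {n : ℕ} (σ : Perm (Fin n))
    (v : EuclideanSpace ℝ (Perm (Fin n))) :
    cycleSum (leftTranslation n) v σ =
      ∑ τ : Perm (Fin n) with ∀ x y, τ.SameCycle x y, v (τ * σ) := by
  simp only [cycleSum, LinearMap.sum_apply, WithLp.ofLp_sum, Finset.sum_apply,
    leftTranslation_apply]
  refine Finset.sum_equiv (Equiv.inv _) ?_ fun g _ => rfl
  simp [Perm.sameCycle_inv]

end RegularRepresentation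

section Graph

open Classical in
theorem mem_graphEigs_iff {V : Type*} [Fintype V] (Γ : SimpleGraph V) (μ : ℝ) :
    μ ∈ graphEigs Γ ↔ ∃ f : V → ℝ, f ≠ 0 ∧ ∀ u, ∑ v with Γ.Adj u v, f v = μ * f u := by
  unfold graphEigs
  rw [Subsingleton.elim (Fintype.ofFinite V) ‹Fintype V›, ← Matrix.spectrum_toLin',
    ← Module.End.hasEigenvalue_iff_mem_spectrum]
  constructor
  · intro h
    obtain ⟨f, hf⟩ := h.exists_hasEigenvector
    refine ⟨f, hf.2, fun u => ?_⟩
    have := congrFun hf.apply_eq_smul u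
    rw [Matrix.toLin'_apply, SimpleGraph.adjMatrix_mulVec_apply] at this
    simpa [SimpleGraph.neighborFinset_eq_filter] using this
  · rintro ⟨f, hf, h⟩
    refine Module.End.hasEigenvalue_of_hasEigenvector (x := f) ⟨?_, hf⟩
    rw [Module.End.mem_eigenspace_iff]
    ext u
    rw [Matrix.toLin'_apply, SimpleGraph.adjMatrix_mulVec_apply]
    simpa [SimpleGraph.neighborFinset_eq_filter] using h u

variable {n : ℕ} {G : Type*} [Group G] [Fintype G] {H : Set G} {φ : G →* Perm (Fin n)}

open Classical in
theorem sum_cayleyGraph (hn : 2 ≤ n) (hφ : Function.Injective φ)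
    (hH : ∀ g, g ∈ H ↔ ∀ x y, (φ g).SameCycle x y)
    (hrange : ∀ σ : Perm (Fin n), (∀ x y, σ.SameCycle x y) → σ ∈ φ.range)
    (F : Perm (Fin n) → ℝ) (u : G) :
    ∑ v with (cayleyGraph H).Adj u v, F (φ v) =
      ∑ τ : Perm (Fin n) with ∀ x y, τ.SameCycle x y, F (τ * φ u) := by
  have hone : (1 : G) ∉ H := by
    rw [hH]
    intro h
    have := h ⟨0, by omega⟩ ⟨1, by omega⟩
    simp at this
  have hinv : ∀ g, g⁻¹ ∈ H ↔ g ∈ H := fun g => by simp [hH, Perm.sameCycle_inv]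
  have hadj : ∀ v, (cayleyGraph H).Adj u v ↔ v * u⁻¹ ∈ H := by
    intro v
    rw [cayleyGraph, SimpleGraph.fromRel_adj, ← hinv (v * u⁻¹)]
    have : (v * u⁻¹)⁻¹ = u * v⁻¹ := by group
    rw [this, or_self]
    refine ⟨fun h => h.2, fun h => ⟨?_, h⟩⟩
    rintro rfl
    exact hone (by simpa using h)
  refine Finset.sum_bij (fun v _ => φ (v * u⁻¹)) ?_ ?_ ?_ ?_
  · intro v hv
    simpa [hadj, hH] using hv
  · intro v _ w _ h
    simpa using hφ h
  · intro τ hτ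
    obtain ⟨g, rfl⟩ := hrange τ (by simpa using hτ)
    exact ⟨g * u, by simpa [hadj, hH] using hτ, by simp⟩
  · intro v _
    rw [← map_mul]; simp

theorem exists_eigenvector_of_mem_graphEigs (hn : 2 ≤ n) (hφ : Function.Injective φ)
    (hH : ∀ g, g ∈ H ↔ ∀ x y, (φ g).SameCycle x y)
    (hrange : ∀ σ : Perm (Fin n), (∀ x y, σ.SameCycle x y) → σ ∈ φ.range)
    {μ : ℝ} (hμ : μ ∈ graphEigs (cayleyGraph H)) :
    ∃ v ≠ 0, cycleSum (leftTranslation n) v = μ • v := by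
  classical
  obtain ⟨f, hf, h⟩ := (mem_graphEigs_iff _ _).mp hμ
  refine ⟨WithLp.toLp 2 (Function.extend φ f 0), fun h0 => hf ?_, ?_⟩
  · ext g
    have := congrArg (fun v => v.ofLp (φ g)) h0
    simpa [hφ.extend_apply] using this
  · ext σ
    rw [cycleSum_leftTranslation_apply]
    simp only [PiLp.smul_apply, smul_eq_mul]
    by_cases hσ : σ ∈ φ.range
    · obtain ⟨u, rfl⟩ := hσ
      rw [← sum_cayleyGraph hn hφ hH hrange]
      simp only [hφ.extend_apply]
      exact h u
    · rw [Function.extend_apply' _ _ _ hσ, Pi.zero_apply, mul_zero]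
      refine Finset.sum_eq_zero fun τ hτ => ?_
      refine Function.extend_apply' _ _ _ fun h => hσ ?_
      exact (Subgroup.mul_mem_cancel_left _ (hrange τ (by simpa using hτ))).mp h

theorem prod_mem_graphEigs {m : ℕ} (hn : m + 1 = n) (hn2 : 2 ≤ n) (hφ : Function.Injective φ)
    (hH : ∀ g, g ∈ H ↔ ∀ x y, (φ g).SameCycle x y)
    (hrange : ∀ σ : Perm (Fin n), (∀ x y, σ.SameCycle x y) → σ ∈ φ.range)
    (F : Perm (Fin n) → ℝ) (hF : F 1 ≠ 0) (a : Fin n → ℝ)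
    (ha : ∀ k σ, ∑ t ∈ Finset.Ioi k, F (swap k t * σ) = a k * F σ) :
    ∏ k : Fin m, a (Fin.cast hn k.castSucc) ∈ graphEigs (cayleyGraph H) := by
  classical
  subst hn
  have h := cycleSum_apply (leftTranslation (m + 1)) a (WithLp.toLp 2 F) (by
    intro k
    ext σ
    rw [jucysMurphy_leftTranslation_apply]
    exact ha k σ)
  rw [mem_graphEigs_iff]
  refine ⟨fun g => F (φ g), fun h0 => hF ?_, fun u => ?_⟩
  · simpa using congrFun h0 1
  · rw [sum_cayleyGraph hn2 hφ hH hrange]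
    have := congrArg (fun v => v.ofLp (φ u)) h
    simp only [cycleSum_leftTranslation_apply] at this
    exact this

end Graph

section Eigenvalues

theorem prod_sub_eq_factorial (m : ℕ) : ∏ k : Fin m, ((m : ℝ) - (k : ℕ)) = m.factorial := by
  induction m with
  | zero => simp
  | succ m ih =>
    rw [Fin.prod_univ_succ, Nat.factorial_succ]
    simp only [Fin.val_succ]
    push_cast
    rw [← ih]
    simp

theorem hook_le_factorial (p q : ℕ) :
    (-1 : ℝ) ^ q * p.factorial * q.factorial ≤ ((p + q).factorial : ℝ) := by
  have h : (p.factorial * q.factorial : ℝ) ≤ ((p + q).factorial : ℝ) := by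
    exact_mod_cast Nat.le_of_dvd (Nat.factorial_pos _) (Nat.factorial_mul_factorial_dvd_factorial_add p q)
  have h0 : (0 : ℝ) ≤ p.factorial * q.factorial := by positivity
  rcases neg_one_pow_eq_or ℝ q with h1 | h1 <;> rw [h1] <;> linarith

theorem factorial_succ_mul_factorial_le (p q : ℕ) (hq : 1 ≤ q) :
    (p + 1).factorial * q.factorial ≤ (p + q).factorial := by
  induction p with
  | zero => simp
  | succ p ih =>
    rw [Nat.factorial_succ (p + 1), show p + 1 + q = (p + q) + 1 by ring,
      Nat.factorial_succ (p + q), mul_assoc]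
    exact Nat.mul_le_mul (by omega) ih

theorem factorial_add_two_mul_factorial_le (p q : ℕ) (hq : 2 ≤ q) :
    (p + 2).factorial * q.factorial ≤ 2 * (p + q).factorial := by
  induction p with
  | zero => simp
  | succ p ih =>
    rw [Nat.factorial_succ (p + 2), show p + 1 + q = (p + q) + 1 by ring,
      Nat.factorial_succ (p + q), mul_assoc, mul_left_comm 2]
    exact Nat.mul_le_mul (by omega) ih

theorem hook_le_of_odd {p q : ℕ} (h : Odd (p + q))
    (hlt : (-1 : ℝ) ^ q * p.factorial * q.factorial < ((p + q).factorial : ℝ)) :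
    (-1 : ℝ) ^ q * p.factorial * q.factorial ≤ ((p + q - 1).factorial : ℝ) := by
  rcases Nat.even_or_odd q with hq | hq
  · rw [hq.neg_one_pow, one_mul] at hlt ⊢
    rcases Nat.eq_zero_or_pos q with rfl | hq0
    · simp at hlt
    obtain ⟨p, rfl⟩ : ∃ p', p = p' + 1 :=
      Nat.exists_eq_succ_of_ne_zero (by rintro rfl; exact (Nat.not_odd_iff_even.mpr hq) (by simpa using h))
    have := factorial_succ_mul_factorial_le p q hq0
    rw [show p + 1 + q - 1 = p + q by omega]
    exact_mod_cast this
  · rw [hq.neg_one_pow]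
    have : (0 : ℝ) ≤ p.factorial * q.factorial := by positivity
    have : (0 : ℝ) ≤ (p + q - 1).factorial := by positivity
    linarith

theorem hook_le_of_even {p q : ℕ} (h : Even (p + q))
    (hlt : (-1 : ℝ) ^ q * p.factorial * q.factorial < ((p + q).factorial : ℝ)) :
    (-1 : ℝ) ^ q * p.factorial * q.factorial ≤ ((2 * (p + q - 2).factorial : ℕ) : ℝ) := by
  rcases Nat.even_or_odd q with hq | hq
  · rw [hq.neg_one_pow, one_mul] at hlt ⊢
    rcases Nat.eq_zero_or_pos q with rfl | hq0
    · simp at hlt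
    have hp : Even p := by simpa [Nat.even_add, hq] using h
    rcases Nat.eq_zero_or_pos p with rfl | hp0
    · simp at hlt
    obtain ⟨p, rfl⟩ : ∃ p', p = p' + 2 := ⟨p - 2, by obtain ⟨r, rfl⟩ := hp; omega⟩
    have := factorial_add_two_mul_factorial_le p q (by obtain ⟨r, rfl⟩ := hq; omega)
    rw [show p + 2 + q - 2 = p + q by omega]
    exact_mod_cast this
  · rw [hq.neg_one_pow]
    have : (0 : ℝ) ≤ p.factorial * q.factorial := by positivity
    have : (0 : ℝ) ≤ ((2 * (p + q - 2).factorial : ℕ) : ℝ) := by positivity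
    linarith

end Eigenvalues

section Eigenvectors

theorem sum_eq_card_mul_add_sum_sub {ι : Type*} [DecidableEq ι] {s T : Finset ι} (hT : T ⊆ s)
    (f : ι → ℝ) (c : ℝ) (h : ∀ t ∈ s, t ∉ T → f t = c) :
    ∑ t ∈ s, f t = s.card * c + ∑ t ∈ T, (f t - c) := by
  rw [Finset.sum_subset hT fun t ht htT => by rw [h t ht htT, sub_self]]
  simp

/-- The coordinate function of `x`. -/
noncomputable def coordinate {n : ℕ} (x i : Fin n) : ℝ := if i = x then 1 else 0

theorem coordinate_swap {n : ℕ} (k t x i : Fin n) :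
    coordinate x (swap k t i) = coordinate (swap k t x) i := by
  simp only [coordinate, swap_apply_eq_iff]

/-- A weight vector of the standard representation twisted by the sign. -/
noncomputable def signStandard {n : ℕ} (a b : Fin n) (σ : Perm (Fin n)) : ℝ :=
  ((Perm.sign σ : ℤ) : ℝ) * (coordinate a (σ a) - coordinate b (σ a))

theorem signStandard_sum (m : ℕ) (k : Fin (m + 2)) (σ : Perm (Fin (m + 2))) :
    ∑ t ∈ Finset.Ioi k, signStandard ⟨m + 1, by omega⟩ ⟨m, by omega⟩ (swap k t * σ) =
      (if (k : ℕ) < m then (k : ℝ) - m else m + 1 - k) *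
        signStandard ⟨m + 1, by omega⟩ ⟨m, by omega⟩ σ := by
  set a : Fin (m + 2) := ⟨m + 1, by omega⟩ with ha
  set b : Fin (m + 2) := ⟨m, by omega⟩ with hb
  have hab : a ≠ b := by simp [ha, hb]
  set s : ℝ := ((Perm.sign σ : ℤ) : ℝ)
  have key : ∀ t ∈ Finset.Ioi k, signStandard a b (swap k t * σ) =
      -s * (coordinate (swap k t a) (σ a) - coordinate (swap k t b) (σ a)) := by
    intro t ht
    rw [signStandard, Perm.sign_mul, Perm.sign_swap (Finset.mem_Ioi.mp ht).ne]
    simp [coordinate_swap, s]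
  rw [Finset.sum_congr rfl key, signStandard]
  by_cases hk : (k : ℕ) < m
  · have hka : k ≠ a := by rintro rfl; simp [ha] at hk
    have hkb : k ≠ b := by rintro rfl; simp [hb] at hk
    rw [if_pos hk, sum_eq_card_mul_add_sum_sub (T := {a, b})
      (c := -s * (coordinate a (σ a) - coordinate b (σ a))), Finset.sum_pair hab,
      swap_apply_right, swap_apply_right, swap_apply_of_ne_of_ne hka.symm hab,
      swap_apply_of_ne_of_ne hkb.symm hab.symm, Fin.card_Ioi,
      show m + 2 - 1 - (k : ℕ) = m - k + 1 by omega]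
    · push_cast [Nat.cast_sub hk.le]
      ring
    · intro t ht
      simp only [Finset.mem_insert, Finset.mem_singleton, ha, hb] at ht
      rw [Finset.mem_Ioi, Fin.lt_def]
      rcases ht with rfl | rfl <;> simp <;> omega
    · intro t _ htT
      simp only [Finset.mem_insert, Finset.mem_singleton, not_or] at htT
      rw [swap_apply_of_ne_of_ne hka.symm (Ne.symm htT.1),
        swap_apply_of_ne_of_ne hkb.symm (Ne.symm htT.2)]
  · rw [if_neg hk]
    rcases (by omega : (k : ℕ) = m ∨ (k : ℕ) = m + 1) with h | h
    · obtain rfl : k = b := Fin.ext h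
      have : Finset.Ioi b = {a} := by
        ext t
        have hav : (a : ℕ) = m + 1 := rfl
        simp only [Finset.mem_Ioi, Finset.mem_singleton, Fin.lt_def, Fin.ext_iff]
        omega
      rw [this, Finset.sum_singleton, swap_apply_right, swap_apply_left, h]
      ring
    · obtain rfl : k = a := Fin.ext h
      have : Finset.Ioi a = ∅ := Finset.eq_empty_of_forall_notMem fun t ht => by
        rw [Finset.mem_Ioi, Fin.lt_def] at ht
        omega
      rw [this, Finset.sum_empty, h]
      push_cast
      ring

/-- A function on pairs of points spanned by the two orientations of the triangle `x y z`. -/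
noncomputable def triangle {n : ℕ} (x y z i j : Fin n) : ℝ :=
  coordinate x i * coordinate y j + coordinate y i * coordinate z j +
      coordinate z i * coordinate x j -
    (coordinate y i * coordinate x j + coordinate z i * coordinate y j +
      coordinate x i * coordinate z j)

theorem triangle_swap {n : ℕ} (k t x y z i j : Fin n) :
    triangle x y z (swap k t i) (swap k t j) =
      triangle (swap k t x) (swap k t y) (swap k t z) i j := by
  simp only [triangle, coordinate_swap]

theorem triangle_sum (m : ℕ) {a b c : Fin (m + 3)} (ha : (a : ℕ) = m + 2) (hb : (b : ℕ) = m + 1)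
    (hc : (c : ℕ) = m) (k i j : Fin (m + 3)) :
    ∑ t ∈ Finset.Ioi k, triangle a b c (swap k t i) (swap k t j) =
      (if (k : ℕ) < m then (m : ℝ) - k else k - (m + 2)) * triangle a b c i j := by
  simp only [triangle_swap]
  have hab : a ≠ b := by rintro rfl; omega
  have hac : a ≠ c := by rintro rfl; omega
  have hbc : b ≠ c := by rintro rfl; omega
  by_cases hk : (k : ℕ) < m
  · have hka : k ≠ a := by rintro rfl; omega
    have hkb : k ≠ b := by rintro rfl; omega
    have hkc : k ≠ c := by rintro rfl; omega
    rw [if_pos hk, sum_eq_card_mul_add_sum_sub (T := {a, b, c}) (c := triangle a b c i j),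
      Finset.sum_insert (by simp [hab, hac]), Finset.sum_pair hbc,
      swap_apply_right, swap_apply_right, swap_apply_right,
      swap_apply_of_ne_of_ne hka.symm hab, swap_apply_of_ne_of_ne hka.symm hac,
      swap_apply_of_ne_of_ne hkb.symm hab.symm, swap_apply_of_ne_of_ne hkb.symm hbc,
      swap_apply_of_ne_of_ne hkc.symm hac.symm, swap_apply_of_ne_of_ne hkc.symm hbc.symm,
      Fin.card_Ioi, show m + 3 - 1 - (k : ℕ) = m - k + 2 by omega]
    · push_cast [Nat.cast_sub hk.le]
      simp only [triangle]
      ring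
    · intro t ht
      simp only [Finset.mem_insert, Finset.mem_singleton] at ht
      rw [Finset.mem_Ioi, Fin.lt_def]
      rcases ht with rfl | rfl | rfl <;> omega
    · intro t _ htT
      simp only [Finset.mem_insert, Finset.mem_singleton, not_or] at htT
      rw [swap_apply_of_ne_of_ne hka.symm (Ne.symm htT.1),
        swap_apply_of_ne_of_ne hkb.symm (Ne.symm htT.2.1),
        swap_apply_of_ne_of_ne hkc.symm (Ne.symm htT.2.2)]
  · rw [if_neg hk]
    rcases (by omega : (k : ℕ) = m ∨ (k : ℕ) = m + 1 ∨ (k : ℕ) = m + 2) with h | h | h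
    · obtain rfl : k = c := Fin.ext (by omega)
      have : Finset.Ioi k = {a, b} := by
        ext t
        simp only [Finset.mem_Ioi, Finset.mem_insert, Finset.mem_singleton, Fin.lt_def,
          Fin.ext_iff]
        omega
      rw [this, Finset.sum_pair hab, swap_apply_right, swap_apply_left, swap_apply_right,
        swap_apply_left, swap_apply_of_ne_of_ne hbc hab.symm, swap_apply_of_ne_of_ne hac hab, h]
      simp only [triangle]
      ring
    · obtain rfl : k = b := Fin.ext (by omega)
      have : Finset.Ioi k = {a} := by
        ext t
        simp only [Finset.mem_Ioi, Finset.mem_singleton, Fin.lt_def, Fin.ext_iff]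
        omega
      rw [this, Finset.sum_singleton, swap_apply_right, swap_apply_left,
        swap_apply_of_ne_of_ne hbc.symm hac.symm, h]
      simp only [triangle]
      push_cast
      ring
    · have : Finset.Ioi k = ∅ := Finset.eq_empty_of_forall_notMem fun t ht => by
        rw [Finset.mem_Ioi, Fin.lt_def] at ht
        omega
      rw [this, Finset.sum_empty, h]
      push_cast
      ring

end Eigenvectors

section Spectrum

theorem forall_sameCycle_iff {n : ℕ} (hn : 2 ≤ n) (σ : Perm (Fin n)) :
    (∀ x y, σ.SameCycle x y) ↔ σ.IsCycle ∧ σ.support.card = n := by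
  constructor
  · intro h
    have : Nontrivial (Fin n) := Fin.nontrivial_iff_two_le.mpr hn
    have hne : ∀ x, σ x ≠ x := by
      intro x hx
      obtain ⟨y, hy⟩ := exists_ne x
      obtain ⟨i, hi⟩ := h x y
      rw [Perm.zpow_apply_eq_self_of_apply_eq_self hx] at hi
      exact hy hi.symm
    refine ⟨⟨⟨0, by omega⟩, hne _, fun y _ => h _ y⟩, ?_⟩
    rw [show σ.support = Finset.univ by ext; simp [hne]]
    simp
  · rintro ⟨h, hs⟩ x y
    have : σ.support = Finset.univ := (Finset.card_eq_iff_eq_univ _).mp (by simpa using hs)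
    exact h.sameCycle (Perm.mem_support.mp (by simp [this])) (Perm.mem_support.mp (by simp [this]))

variable {n : ℕ} {G : Type*} [Group G] [Fintype G] {H : Set G} {φ : G →* Perm (Fin n)}

theorem eq_hook_of_mem_graphEigs (hn : 2 ≤ n) (hφ : Function.Injective φ)
    (hH : ∀ g, g ∈ H ↔ ∀ x y, (φ g).SameCycle x y)
    (hrange : ∀ σ : Perm (Fin n), (∀ x y, σ.SameCycle x y) → σ ∈ φ.range)
    {μ : ℝ} (hμ : μ ∈ graphEigs (cayleyGraph H)) :
    μ = 0 ∨ ∃ p q : ℕ, p + q = n - 1 ∧ μ = (-1) ^ q * p.factorial * q.factorial := by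
  obtain ⟨v, hv, h⟩ := exists_eigenvector_of_mem_graphEigs hn hφ hH hrange hμ
  obtain ⟨m, rfl⟩ : ∃ m, n = m + 1 := ⟨n - 1, by omega⟩
  exact eigenvalue_cycleSum (ρ := leftTranslation (m + 1)) inner_leftTranslation hv h

theorem isGreatest_graphEigs (hn : 2 ≤ n) (hφ : Function.Injective φ)
    (hH : ∀ g, g ∈ H ↔ ∀ x y, (φ g).SameCycle x y)
    (hrange : ∀ σ : Perm (Fin n), (∀ x y, σ.SameCycle x y) → σ ∈ φ.range) :
    IsGreatest (graphEigs (cayleyGraph H)) ((n - 1).factorial : ℝ) := by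
  constructor
  · obtain ⟨m, rfl⟩ : ∃ m, n = m + 1 := ⟨n - 1, by omega⟩
    have := prod_mem_graphEigs rfl hn hφ hH hrange (fun _ => 1) one_ne_zero
      (fun k => (m : ℝ) - (k : ℕ)) (fun k σ => by
        simp [Nat.cast_sub (Nat.lt_succ_iff.mp k.2)])
    simpa [prod_sub_eq_factorial] using this
  · intro μ hμ
    obtain rfl | ⟨p, q, hpq, rfl⟩ := eq_hook_of_mem_graphEigs hn hφ hH hrange hμ
    · positivity
    · rw [← hpq]
      exact hook_le_factorial p q

theorem isGreatest_of_even (hn : 4 < n) (heven : Even n) (hφ : Function.Injective φ)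
    (hH : ∀ g, g ∈ H ↔ ∀ x y, (φ g).SameCycle x y)
    (hrange : ∀ σ : Perm (Fin n), (∀ x y, σ.SameCycle x y) → σ ∈ φ.range) :
    IsGreatest {μ : ℝ | μ ∈ graphEigs (cayleyGraph H) ∧ μ < ((n - 1).factorial : ℝ)}
      ((n - 2).factorial : ℝ) := by
  have hn2 : 2 ≤ n := by omega
  refine ⟨⟨?_, ?_⟩, ?_⟩
  · obtain ⟨m, rfl⟩ : ∃ m, n = m + 2 := ⟨n - 2, by omega⟩
    have hm : Even m := by simpa [Nat.even_add] using heven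
    have := prod_mem_graphEigs (m := m + 1) rfl hn2 hφ hH hrange _
      (by simp [signStandard, coordinate])
      (fun k => if (k : ℕ) < m then ((k : ℕ) : ℝ) - m else m + 1 - (k : ℕ)) (signStandard_sum m)
    rw [Fin.prod_univ_castSucc] at this
    simp only [Fin.cast_refl, id, Fin.val_castSucc, Fin.is_lt, if_true, Fin.val_last,
      lt_irrefl, if_false, add_sub_cancel_left, mul_one] at this
    rw [Nat.add_sub_cancel, ← prod_sub_eq_factorial, ← one_mul (∏ _, _), ← hm.neg_one_pow]
    have hneg := Finset.prod_neg (s := Finset.univ) fun k : Fin m => (m : ℝ) - (k : ℕ)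
    simp only [neg_sub, Finset.card_univ, Fintype.card_fin] at hneg
    rwa [← hneg]
  · exact_mod_cast (Nat.factorial_lt (by omega)).mpr (by omega)
  · rintro μ ⟨hμ, hlt⟩
    obtain rfl | ⟨p, q, hpq, rfl⟩ := eq_hook_of_mem_graphEigs hn2 hφ hH hrange hμ
    · positivity
    · rw [← hpq] at hlt
      have hodd : Odd (p + q) := by
        rw [hpq]; obtain ⟨r, rfl⟩ := heven; exact ⟨r - 1, by omega⟩
      have := hook_le_of_odd hodd hlt
      rwa [show p + q - 1 = n - 2 by omega] at this

theorem isGreatest_of_odd (hn : 4 < n) (hodd : Odd n) (hφ : Function.Injective φ)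
    (hH : ∀ g, g ∈ H ↔ ∀ x y, (φ g).SameCycle x y)
    (hrange : ∀ σ : Perm (Fin n), (∀ x y, σ.SameCycle x y) → σ ∈ φ.range) :
    IsGreatest {μ : ℝ | μ ∈ graphEigs (cayleyGraph H) ∧ μ < ((n - 1).factorial : ℝ)}
      ((2 * (n - 3).factorial : ℕ) : ℝ) := by
  have hn2 : 2 ≤ n := by omega
  refine ⟨⟨?_, ?_⟩, ?_⟩
  · obtain ⟨m, rfl⟩ : ∃ m, n = m + 3 := ⟨n - 3, by omega⟩
    obtain ⟨a, ha⟩ : ∃ a : Fin (m + 3), (a : ℕ) = m + 2 := ⟨⟨m + 2, by omega⟩, rfl⟩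
    obtain ⟨b, hb⟩ : ∃ b : Fin (m + 3), (b : ℕ) = m + 1 := ⟨⟨m + 1, by omega⟩, rfl⟩
    obtain ⟨c, hc⟩ : ∃ c : Fin (m + 3), (c : ℕ) = m := ⟨⟨m, by omega⟩, rfl⟩
    have hab : a ≠ b := by rintro rfl; omega
    have hac : a ≠ c := by rintro rfl; omega
    have hbc : b ≠ c := by rintro rfl; omega
    have := prod_mem_graphEigs (m := m + 2) rfl hn2 hφ hH hrange
      (fun σ => triangle a b c (σ a) (σ b)) (by simp [triangle, coordinate, hab, hac, hbc, hab.symm])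
      (fun k => if (k : ℕ) < m then (m : ℝ) - (k : ℕ) else (k : ℕ) - (m + 2))
      (fun k σ => triangle_sum m ha hb hc k (σ a) (σ b))
    rw [Fin.prod_univ_castSucc, Fin.prod_univ_castSucc] at this
    simp only [Fin.cast_refl, id, Fin.val_castSucc, Fin.is_lt, if_true, Fin.val_last,
      lt_irrefl, if_false, prod_sub_eq_factorial, not_lt.mpr (Nat.le_succ m)] at this
    rw [Nat.add_sub_cancel]
    refine Eq.mp (congrArg (· ∈ _) ?_) this
    push_cast
    ring
  · have h : 2 * (n - 3).factorial < (n - 1).factorial := by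
      obtain ⟨m, rfl⟩ : ∃ m, n = m + 3 := ⟨n - 3, by omega⟩
      rw [show m + 3 - 1 = m + 1 + 1 by omega, Nat.factorial_succ, Nat.factorial_succ,
        Nat.add_sub_cancel]
      rw [← mul_assoc]
      exact Nat.mul_lt_mul_of_pos_right (by nlinarith) (Nat.factorial_pos m)
    exact_mod_cast h
  · rintro μ ⟨hμ, hlt⟩
    obtain rfl | ⟨p, q, hpq, rfl⟩ := eq_hook_of_mem_graphEigs hn2 hφ hH hrange hμ
    · positivity
    · rw [← hpq] at hlt
      have heven : Even (p + q) := by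
        rw [hpq]; obtain ⟨r, rfl⟩ := hodd; exact ⟨r, by omega⟩
      have := hook_le_of_even heven hlt
      rwa [show p + q - 2 = n - 3 by omega] at this

theorem mem_alternatingGroup_of_forall_sameCycle (hn : 2 ≤ n) (hodd : Odd n)
    {σ : Perm (Fin n)} (h : ∀ x y, σ.SameCycle x y) : σ ∈ alternatingGroup (Fin n) := by
  obtain ⟨hσ, hs⟩ := (forall_sameCycle_iff hn σ).mp h
  rw [Perm.mem_alternatingGroup, hσ.sign, hs, hodd.neg_one_pow, neg_neg]

end Spectrum

/-- Let `n > 4`, `H = C(n,n)` the set of all `n`-cycles, `G = S_n` for `n` even and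
`G = A_n` for `n` odd, and `Γ = Cay(G,H)`.  Then `λ₁(Γ) = (n-1)!`; moreover
`λ₂(Γ) = (n-2)!` for `n` even and `λ₂(Γ) = 2·(n-3)!` for `n` odd. -/
theorem stmt0 (n : ℕ) (hn : 4 < n) :
    (Even n →
      IsGreatest (graphEigs (cayleyGraph (fullCycles n))) ((n - 1).factorial : ℝ) ∧
      IsGreatest
        {μ : ℝ | μ ∈ graphEigs (cayleyGraph (fullCycles n)) ∧ μ < ((n - 1).factorial : ℝ)}
        ((n - 2).factorial : ℝ)) ∧
    (Odd n →
      IsGreatest (graphEigs (cayleyGraph (fullCyclesAlt n))) ((n - 1).factorial : ℝ) ∧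
      IsGreatest
        {μ : ℝ | μ ∈ graphEigs (cayleyGraph (fullCyclesAlt n)) ∧ μ < ((n - 1).factorial : ℝ)}
        ((2 * (n - 3).factorial : ℕ) : ℝ)) := by
  refine ⟨fun heven => ?_, fun hodd => ?_⟩
  · have hH (g : Perm (Fin n)) :
        g ∈ fullCycles n ↔ ∀ x y, (MonoidHom.id (Perm (Fin n)) g).SameCycle x y :=
      (forall_sameCycle_iff (by omega) g).symm
    exact ⟨isGreatest_graphEigs (by omega) Function.injective_id hH fun σ _ => ⟨σ, rfl⟩,
      isGreatest_of_even hn heven Function.injective_id hH fun σ _ => ⟨σ, rfl⟩⟩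
  · have hH (g : alternatingGroup (Fin n)) :
        g ∈ fullCyclesAlt n ↔ ∀ x y, ((alternatingGroup (Fin n)).subtype g).SameCycle x y :=
      (forall_sameCycle_iff (by omega) (g : Perm (Fin n))).symm
    have hrange (σ : Perm (Fin n)) (h : ∀ x y, σ.SameCycle x y) :
        σ ∈ (alternatingGroup (Fin n)).subtype.range := by
      rw [Subgroup.range_subtype]
      exact mem_alternatingGroup_of_forall_sameCycle (by omega) hodd h
    exact ⟨isGreatest_graphEigs (by omega) (Subgroup.subtype_injective _) hH hrange,
      isGreatest_of_odd hn hodd (Subgroup.subtype_injective _) hH hrange⟩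
end

section
/- Let n > 4 and let H = C(n,n−1) be the set of all (n−1)-cycles in S_n. Let G = S_n if n is odd and G = A_n if n is even, and let Γ = Cay(G,H). Then λ1(Γ) = n·(n−2)!. Furthermore, λ2(Γ) = 3(n−3)·(n−5)! when n is even and λ2(Γ) = 2(n−2)·(n−4)! when n is odd. -/
open Equiv

/-- The set of `(n-1)`-cycles, as a subset of `S_n`. -/
def nm1Cycles (n : ℕ) : Set (Perm (Fin n)) :=
  {g : Perm (Fin n) | g.IsCycle ∧ g.support.card = n - 1}

/-- The set of `(n-1)`-cycles, as a subset of `A_n`. -/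
def nm1CyclesAlt (n : ℕ) : Set (alternatingGroup (Fin n)) :=
  {g : alternatingGroup (Fin n) |
    (g : Perm (Fin n)).IsCycle ∧ (g : Perm (Fin n)).support.card = n - 1}


namespace FullCycle

open Finset

variable {α : Type*} [DecidableEq α]

/-- `σ` permutes `S` transitively and fixes every point outside `S`. -/
def IsFullCycle (S : Finset α) (σ : Perm α) : Prop :=
  (∀ x ∉ S, σ x = x) ∧ ∀ T ⊆ S, T.Nonempty → (∀ x ∈ T, σ x ∈ T) → T = S

noncomputable instance (S : Finset α) : DecidablePred (IsFullCycle S) := Classical.decPred _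

theorem apply_mem_of_fixes_compl {S : Finset α} {σ : Perm α} (h : ∀ x ∉ S, σ x = x) {x : α}
    (hx : x ∈ S) : σ x ∈ S := by
  by_contra hσ
  have := σ.injective (h _ hσ)
  exact hσ (this.symm ▸ hx)

theorem IsFullCycle.mul_swap {S : Finset α} {τ : Perm α} (h : IsFullCycle S τ) {i s : α}
    (hi : i ∉ S) (hs : s ∈ S) : IsFullCycle (insert i S) (τ * swap i s) := by
  have hsi : s ≠ i := fun e => hi (e ▸ hs)
  have hτs : τ s ≠ i := fun e => hi (e ▸ apply_mem_of_fixes_compl h.1 hs)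
  have h1 : (τ * swap i s) i = τ s := by simp
  have h2 : (τ * swap i s) s = i := by simp [h.1 i hi]
  have h3 : ∀ x, x ≠ i → x ≠ s → (τ * swap i s) x = τ x := fun x hx hx' => by
    simp [swap_apply_of_ne_of_ne hx hx']
  refine ⟨fun x hx => ?_, fun T hT hTn hTc => ?_⟩
  · rw [mem_insert, not_or] at hx
    rw [h3 x hx.1 (fun e => hx.2 (e ▸ hs)), h.1 x hx.2]
  · have key : T.erase i = S := by
      refine h.2 _ (fun x hx => ?_) ?_ (fun x hx => ?_)
      · rw [mem_erase] at hx
        exact (mem_insert.1 (hT hx.2)).resolve_left hx.1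
      · obtain ⟨x, hx⟩ := hTn
        by_cases hxi : x = i
        · subst hxi
          exact ⟨τ s, mem_erase.2 ⟨hτs, h1 ▸ hTc _ hx⟩⟩
        · exact ⟨x, mem_erase.2 ⟨hxi, hx⟩⟩
      · rw [mem_erase] at hx ⊢
        refine ⟨fun e => hx.1 (τ.injective (e.trans (h.1 i hi).symm)), ?_⟩
        by_cases hxs : x = s
        · subst hxs
          have : i ∈ T := h2 ▸ hTc _ hx.2
          exact h1 ▸ hTc _ this
        · exact h3 x hx.1 hxs ▸ hTc _ hx.2
    have hsT : s ∈ T := (mem_erase.1 (key.symm ▸ hs)).2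
    have hiT : i ∈ T := h2 ▸ hTc _ hsT
    rw [← key, insert_erase hiT]

theorem IsFullCycle.exists_eq_mul_swap {S : Finset α} {σ : Perm α} {i : α} (hi : i ∉ S)
    (hS : S.Nonempty) (h : IsFullCycle (insert i S) σ) :
    σ⁻¹ i ∈ S ∧ IsFullCycle S (σ * swap i (σ⁻¹ i)) := by
  set s := σ⁻¹ i with hsdef
  have hσs : σ s = i := by simp [hsdef]
  have hsi : s ≠ i := by
    intro e
    obtain ⟨x, hx⟩ := hS
    have := h.2 {i} (by simp) (by simp) (by
      intro x hx
      rw [mem_singleton] at hx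
      subst hx
      rw [e] at hσs
      simp [hσs])
    have hx' : x ∈ ({i} : Finset α) := this ▸ mem_insert_of_mem hx
    exact hi (mem_singleton.1 hx' ▸ hx)
  have hs : s ∈ S := by
    by_contra hs
    have := h.1 s (by simp [hs, hsi])
    exact hsi (this.symm.trans hσs)
  have h1 : (σ * swap i s) i = i := by simp [hσs]
  have h2 : (σ * swap i s) s = σ i := by simp
  have h3 : ∀ x, x ≠ i → x ≠ s → (σ * swap i s) x = σ x := fun x hx hx' => by
    simp [swap_apply_of_ne_of_ne hx hx']
  refine ⟨hs, fun x hx => ?_, fun T hT hTn hTc => ?_⟩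
  · by_cases hxi : x = i
    · rw [hxi, h1]
    · rw [h3 x hxi (fun e => hx (e ▸ hs)), h.1 x (by simp [hx, hxi])]
  · have hiT : i ∉ T := fun e => hi (hT e)
    by_cases hsT : s ∈ T
    · have := h.2 (insert i T) (insert_subset_insert _ hT) (insert_nonempty _ _) (by
        intro x hx
        rcases mem_insert.1 hx with rfl | hx
        · exact mem_insert_of_mem (h2 ▸ hTc _ hsT)
        · by_cases hxs : x = s
          · rw [hxs, hσs]; exact mem_insert_self _ _
          · exact mem_insert_of_mem (h3 x (fun e => hiT (e ▸ hx)) hxs ▸ hTc _ hx))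
      rw [← erase_insert hiT, this, erase_insert hi]
    · have := h.2 T (hT.trans (subset_insert _ _)) hTn (by
        intro x hx
        exact h3 x (fun e => hiT (e ▸ hx)) (fun e => hsT (e ▸ hx)) ▸ hTc _ hx)
      exact absurd (this ▸ mem_insert_self i S) hiT

theorem isFullCycle_singleton (x : α) (σ : Perm α) : IsFullCycle {x} σ ↔ σ = 1 := by
  constructor
  · intro h
    have hx : ∀ y, y ≠ x → σ y = y := fun y hy => h.1 y (by simpa using hy)
    ext y
    by_cases hy : y = x
    · subst hy
      have := apply_mem_of_fixes_compl h.1 (mem_singleton_self y)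
      simpa using this
    · simpa using hx y hy
  · rintro rfl
    refine ⟨fun _ _ => rfl, fun T hT hTn _ => ?_⟩
    exact (hTn.subset_singleton_iff).1 hT

theorem IsFullCycle.inv {S : Finset α} {σ : Perm α} (h : IsFullCycle S σ) :
    IsFullCycle S σ⁻¹ := by
  refine ⟨fun x hx => ?_, fun T hT hTn hTc => h.2 T hT hTn fun x hx => ?_⟩
  · rw [Perm.inv_eq_iff_eq, h.1 x hx]
  · have himg : T.image (⇑σ⁻¹) = T := by
      refine eq_of_subset_of_card_le ?_ (card_image_of_injective _ (σ⁻¹).injective).ge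
      intro y hy
      obtain ⟨z, hz, rfl⟩ := mem_image.1 hy
      exact hTc z hz
    rw [← himg, mem_image] at hx
    obtain ⟨y, hy, rfl⟩ := hx
    simpa using hy

theorem IsFullCycle.conj {S S' : Finset α} {σ : Perm α} (h : IsFullCycle S σ) {g : Perm α}
    (hg : ∀ x, g x ∈ S' ↔ x ∈ S) : IsFullCycle S' (g * σ * g⁻¹) := by
  have hg' : ∀ x, g⁻¹ x ∈ S ↔ x ∈ S' := fun x => by rw [← hg]; simp
  refine ⟨fun x hx => ?_, fun T hT hTn hTc => ?_⟩
  · rw [Perm.mul_apply, Perm.mul_apply, h.1 (g⁻¹ x) (by rwa [hg'])]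
    simp
  · have := h.2 (T.image (⇑g⁻¹)) ?_ (hTn.image _) ?_
    · ext x
      rw [← hg' x, ← this, mem_image]
      constructor
      · exact fun hx => ⟨x, hx, rfl⟩
      · rintro ⟨y, hy, e⟩
        rwa [← (g⁻¹).injective e]
    · intro y hy
      obtain ⟨z, hz, rfl⟩ := mem_image.1 hy
      exact (hg' z).2 (hT hz)
    · intro y hy
      obtain ⟨z, hz, rfl⟩ := mem_image.1 hy
      exact mem_image.2 ⟨_, hTc z hz, by simp⟩

theorem isFullCycle_iff_isCycle [Fintype α] {S : Finset α} (hS : 2 ≤ #S) (σ : Perm α) :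
    IsFullCycle S σ ↔ σ.IsCycle ∧ σ.support = S := by
  constructor
  · intro h
    have hne : ∀ x ∈ S, σ x ≠ x := by
      intro x hx e
      have := h.2 {x} (by simpa using hx) (by simp) (by simp [e])
      rw [← this] at hS
      simp at hS
    have hsupp : σ.support = S := by
      ext x
      rw [Perm.mem_support]
      exact ⟨fun hx => by by_contra hxS; exact hx (h.1 x hxS), hne x⟩
    refine ⟨?_, hsupp⟩
    obtain ⟨x, hx⟩ : S.Nonempty := card_pos.1 (by omega)
    refine ⟨x, hne x hx, fun y hy => ?_⟩
    classical
    have := h.2 (S.filter fun z => σ.SameCycle x z) (filter_subset _ _)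
      ⟨x, by simp [hx, Perm.SameCycle.refl]⟩ (by
        intro z hz
        rw [mem_filter] at hz ⊢
        exact ⟨apply_mem_of_fixes_compl h.1 hz.1, Perm.sameCycle_apply_right.2 hz.2⟩)
    have hyS : y ∈ S := by rw [← hsupp]; exact Perm.mem_support.2 hy
    rw [← this] at hyS
    exact (mem_filter.1 hyS).2
  · rintro ⟨hc, rfl⟩
    refine ⟨fun x hx => by simpa using hx, fun T hT hTn hTc => hT.antisymm fun y hy => ?_⟩
    obtain ⟨x, hx⟩ := hTn
    obtain ⟨m, rfl⟩ := hc.exists_pow_eq (Perm.mem_support.1 (hT hx)) (Perm.mem_support.1 hy)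
    clear hy
    induction m with
    | zero => simpa using hx
    | succ m ih => rw [pow_succ', Perm.mul_apply]; exact hTc _ ih

section Operators

variable {V : Type*} [AddCommGroup V] [Module ℝ V]

/-- The action of the sum of all full cycles on `S`. -/
noncomputable def fullSum [Fintype α] (ρ : Perm α →* Module.End ℝ V) (S : Finset α) :
    Module.End ℝ V :=
  ∑ σ with IsFullCycle S σ, ρ σ

/-- The action of the sum of the transpositions `(i s)`, `s ∈ S` (a Jucys–Murphy element). -/
noncomputable def swapSum (ρ : Perm α →* Module.End ℝ V) (S : Finset α) (i : α) :
    Module.End ℝ V :=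
  ∑ s ∈ S, ρ (swap i s)

/-- The action of the sum of the transpositions `(c b)`, `b ∈ B`, `c ∈ C`. -/
noncomputable def crossSum (ρ : Perm α →* Module.End ℝ V) (B C : Finset α) : Module.End ℝ V :=
  ∑ c ∈ C, swapSum ρ B c

/-- Transpositions inside `B` act on `v` by `-1`. -/
def IsAlt (ρ : Perm α →* Module.End ℝ V) (B : Finset α) (v : V) : Prop :=
  ∀ x ∈ B, ∀ y ∈ B, x ≠ y → ρ (swap x y) v = -v

/-- Transpositions inside `C` fix `v`. -/
def IsSym (ρ : Perm α →* Module.End ℝ V) (C : Finset α) (v : V) : Prop :=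
  ∀ x ∈ C, ∀ y ∈ C, ρ (swap x y) v = v

variable {ρ : Perm α →* Module.End ℝ V}

theorem IsAlt.mono {B B' : Finset α} {v : V} (h : IsAlt ρ B v) (hB : B' ⊆ B) : IsAlt ρ B' v :=
  fun x hx y hy => h x (hB hx) y (hB hy)

theorem IsSym.mono {B B' : Finset α} {v : V} (h : IsSym ρ B v) (hB : B' ⊆ B) : IsSym ρ B' v :=
  fun x hx y hy => h x (hB hx) y (hB hy)

theorem swap_swap_apply (x y z w : α) (v : V) :
    ρ (swap x y) (ρ (swap z w) v) =
      ρ (swap (swap x y z) (swap x y w)) (ρ (swap x y) v) := by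
  rw [← Module.End.mul_apply, ← Module.End.mul_apply, ← map_mul, ← map_mul,
    Equiv.mul_swap_eq_swap_mul]

theorem swap_self_apply (x y : α) (v : V) : ρ (swap x y) (ρ (swap x y) v) = v := by
  rw [← Module.End.mul_apply, ← map_mul, Equiv.swap_mul_self, map_one, Module.End.one_apply]

theorem swap_adjacent {a b c : α} (hac : a ≠ c) (hbc : b ≠ c) (v : V) :
    ρ (swap a b) (ρ (swap b c) v) = ρ (swap a c) (ρ (swap a b) v) := by
  rw [swap_swap_apply, swap_apply_right, swap_apply_of_ne_of_ne hac.symm hbc.symm]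

theorem swapSum_apply (S : Finset α) (i : α) (v : V) :
    swapSum ρ S i v = ∑ s ∈ S, ρ (swap i s) v := by
  rw [swapSum, LinearMap.sum_apply]

theorem crossSum_apply (B C : Finset α) (v : V) :
    crossSum ρ B C v = ∑ c ∈ C, swapSum ρ B c v := by
  rw [crossSum, LinearMap.sum_apply]

/-- An element preserving `S` and fixing `i` commutes with `swapSum ρ S i`. -/
theorem apply_swapSum {S : Finset α} {g : Perm α} (hg : ∀ x, g x ∈ S ↔ x ∈ S) (i : α) (v : V) :
    ρ g (swapSum ρ S i v) = swapSum ρ S (g i) (ρ g v) := by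
  rw [swapSum_apply, swapSum_apply, map_sum]
  refine sum_bij (fun x _ => g x) (fun x hx => (hg x).2 hx) (fun x _ y _ e => g.injective e)
    (fun y hy => ⟨g⁻¹ y, by rw [← hg]; simpa using hy, by simp⟩) (fun x _ => ?_)
  rw [← Module.End.mul_apply, ← Module.End.mul_apply, ← map_mul, ← map_mul,
    Equiv.mul_swap_eq_swap_mul]

theorem swap_mem_iff_of_mem {S : Finset α} {x y : α} (hx : x ∈ S) (hy : y ∈ S) (z : α) :
    swap x y z ∈ S ↔ z ∈ S := by
  rw [swap_apply_def]
  split_ifs with h h' <;> simp_all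

theorem swap_mem_iff_of_notMem {S : Finset α} {x y : α} (hx : x ∉ S) (hy : y ∉ S) (z : α) :
    swap x y z ∈ S ↔ z ∈ S := by
  rw [swap_apply_def]
  split_ifs with h h' <;> simp_all

theorem IsAlt.swapSum_eq_smul {S : Finset α} {i : α} {v : V} (h : IsAlt ρ (insert i S) v)
    (hi : i ∉ S) : swapSum ρ S i v = -(#S : ℝ) • v := by
  rw [swapSum_apply, sum_congr rfl (g := fun _ => -v)]
  · simp [Nat.cast_smul_eq_nsmul]
  · intro s hs
    exact h i (mem_insert_self _ _) s (mem_insert_of_mem hs) (fun e => hi (e ▸ hs))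

theorem IsSym.swapSum_eq_smul {S : Finset α} {i : α} {v : V} (h : IsSym ρ (insert i S) v) :
    swapSum ρ S i v = (#S : ℝ) • v := by
  rw [swapSum_apply, sum_congr rfl (g := fun _ => v)]
  · simp [Nat.cast_smul_eq_nsmul]
  · intro s hs
    exact h i (mem_insert_self _ _) s (mem_insert_of_mem hs)

section FullSum

variable [Fintype α]

theorem fullSum_apply (S : Finset α) (v : V) :
    fullSum ρ S v = ∑ σ with IsFullCycle S σ, ρ σ v := by
  rw [fullSum, LinearMap.sum_apply]

theorem apply_fullSum {S S' : Finset α} {g : Perm α} (hg : ∀ x, g x ∈ S' ↔ x ∈ S) (v : V) :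
    ρ g (fullSum ρ S v) = fullSum ρ S' (ρ g v) := by
  have hg' : ∀ x, g⁻¹ x ∈ S ↔ x ∈ S' := fun x => by rw [← hg]; simp
  rw [fullSum_apply, fullSum_apply, map_sum]
  refine sum_bij' (fun σ _ => g * σ * g⁻¹) (fun σ _ => g⁻¹ * σ * g) ?_ ?_ ?_ ?_ ?_
  · intro σ hσ
    simp only [mem_filter, mem_univ, true_and] at hσ ⊢
    exact hσ.conj hg
  · intro σ hσ
    simp only [mem_filter, mem_univ, true_and] at hσ ⊢
    simpa using hσ.conj hg'
  · intro σ _; group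
  · intro σ _; group
  · intro σ _
    rw [← Module.End.mul_apply, ← Module.End.mul_apply, ← map_mul, ← map_mul]
    congr 2
    group

theorem fullSum_insert {S : Finset α} {i : α} (hi : i ∉ S) (hS : S.Nonempty) (v : V) :
    fullSum ρ (insert i S) v = fullSum ρ S (swapSum ρ S i v) := by
  have : fullSum ρ S (swapSum ρ S i v) =
      ∑ p ∈ (univ.filter (IsFullCycle S)) ×ˢ S, ρ (p.1 * swap i p.2) v := by
    rw [sum_product, fullSum_apply]
    refine sum_congr rfl fun σ _ => ?_
    rw [swapSum_apply, map_sum]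
    simp [Module.End.mul_apply]
  rw [this, fullSum_apply]
  refine sum_bij' (fun σ _ => (σ * swap i (σ⁻¹ i), σ⁻¹ i)) (fun p _ => p.1 * swap i p.2)
    ?_ ?_ ?_ ?_ ?_
  · intro σ hσ
    simp only [mem_filter, mem_univ, true_and, mem_product] at hσ ⊢
    exact (hσ.exists_eq_mul_swap hi hS).symm
  · rintro ⟨τ, s⟩ hp
    simp only [mem_filter, mem_univ, true_and, mem_product] at hp ⊢
    exact hp.1.mul_swap hi hp.2
  · intro σ _
    simp [mul_assoc]
  · rintro ⟨τ, s⟩ hp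
    simp only [mem_filter, mem_univ, true_and, mem_product] at hp
    have hτ : τ⁻¹ i = i := by rw [Perm.inv_eq_iff_eq, hp.1.1 i hi]
    have : (τ * swap i s)⁻¹ i = s := by
      rw [mul_inv_rev, Perm.mul_apply, hτ, swap_inv, swap_apply_left]
    simp only [this, Prod.mk.injEq, and_true]
    rw [mul_assoc, swap_mul_self, mul_one]
  · intro σ _
    simp [mul_assoc]

theorem fullSum_insert' {S : Finset α} {i : α} (hi : i ∉ S) (hS : S.Nonempty) (v : V) :
    fullSum ρ (insert i S) v = swapSum ρ S i (fullSum ρ S v) := by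
  rw [fullSum_insert hi hS, fullSum_apply, fullSum_apply, map_sum]
  refine sum_congr rfl fun σ hσ => ?_
  simp only [mem_filter, mem_univ, true_and] at hσ
  have hS' : ∀ x, σ x ∈ S ↔ x ∈ S := fun x =>
    ⟨fun h => by by_contra hx; exact hx (hσ.1 x hx ▸ h), apply_mem_of_fixes_compl hσ.1⟩
  rw [apply_swapSum hS', hσ.1 i hi]

theorem fullSum_singleton (x : α) (v : V) : fullSum ρ {x} v = v := by
  rw [fullSum_apply, sum_eq_single 1]
  · simp
  · exact fun σ hσ hne => absurd ((isFullCycle_singleton x σ).1 (mem_filter.1 hσ).2) hne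
  · simp [isFullCycle_singleton]

theorem IsAlt.fullSum_eq_smul {S : Finset α} {v : V} (hS : S.Nonempty) (h : IsAlt ρ S v) :
    fullSum ρ S v = ((-1) ^ (#S - 1) * (#S - 1).factorial : ℝ) • v := by
  induction hS using Finset.Nonempty.cons_induction with
  | singleton a => simp [fullSum_singleton]
  | cons a s ha hs ih =>
    rw [cons_eq_insert] at h ⊢
    rw [fullSum_insert ha hs, h.swapSum_eq_smul ha, map_smul, ih (h.mono (subset_insert _ _)),
      smul_smul, card_insert_of_notMem ha]
    obtain ⟨m, hm⟩ := Nat.exists_eq_succ_of_ne_zero (card_pos.2 hs).ne'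
    rw [hm]
    congr 1
    simp only [Nat.succ_eq_add_one, add_tsub_cancel_right, Nat.factorial_succ]
    push_cast
    ring

theorem IsSym.fullSum_eq_smul {S : Finset α} {v : V} (hS : S.Nonempty) (h : IsSym ρ S v) :
    fullSum ρ S v = ((#S - 1).factorial : ℝ) • v := by
  induction hS using Finset.Nonempty.cons_induction with
  | singleton a => simp [fullSum_singleton]
  | cons a s ha hs ih =>
    rw [cons_eq_insert] at h ⊢
    rw [fullSum_insert ha hs, h.swapSum_eq_smul, map_smul, ih (h.mono (subset_insert _ _)),
      smul_smul, card_insert_of_notMem ha]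
    obtain ⟨m, hm⟩ := Nat.exists_eq_succ_of_ne_zero (card_pos.2 hs).ne'
    rw [hm]
    congr 1
    simp only [Nat.succ_eq_add_one, add_tsub_cancel_right, Nat.factorial_succ]
    push_cast
    ring

end FullSum

theorem swapSum_erase {B : Finset α} {b : α} (hb : b ∈ B) (i : α) (v : V) :
    swapSum ρ (B.erase b) i v = swapSum ρ B i v - ρ (swap i b) v := by
  rw [swapSum_apply, swapSum_apply, ← add_sum_erase _ _ hb, add_sub_cancel_left]

theorem swapSum_union {B C : Finset α} (h : Disjoint B C) (i : α) (v : V) :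
    swapSum ρ (B ∪ C) i v = swapSum ρ B i v + swapSum ρ C i v := by
  rw [swapSum_apply, swapSum_apply, swapSum_apply, sum_union h]

theorem crossSum_comm (B C : Finset α) (v : V) : crossSum ρ C B v = crossSum ρ B C v := by
  simp only [crossSum_apply, swapSum_apply]
  rw [sum_comm]
  simp only [swap_comm]

theorem crossSum_erase_right {B C : Finset α} {c : α} (hc : c ∈ C) (v : V) :
    crossSum ρ B (C.erase c) v = crossSum ρ B C v - swapSum ρ B c v := by
  rw [crossSum_apply, crossSum_apply, ← add_sum_erase _ _ hc, add_sub_cancel_left]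

theorem crossSum_erase_left {B C : Finset α} {b : α} (hb : b ∈ B) (v : V) :
    crossSum ρ (B.erase b) C v = crossSum ρ B C v - swapSum ρ C b v := by
  rw [← crossSum_comm, crossSum_erase_right hb, crossSum_comm]

theorem double_swap_mul {b b' c c' : α} (hbb : b ≠ b') (hcc : c ≠ c') (h1 : b ≠ c) (h2 : b ≠ c')
    (h3 : b' ≠ c) (h4 : b' ≠ c') :
    swap c b' * swap c' b * (swap c c' * swap b b') = swap c b * swap c' b' := by
  ext z
  simp only [Perm.mul_apply, swap_apply_def]
  grind

/-- Two crossings between an alternating and a symmetric block cancel in pairs. -/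
theorem IsAlt.swapSum_swapSum_of_ne {B : Finset α} {v : V} (h : IsAlt ρ B v) {c c' : α}
    (hc : c ∉ B) (hc' : c' ∉ B) (hcc : c ≠ c') (hv : ρ (swap c c') v = v) :
    swapSum ρ B c (swapSum ρ B c' v) = swapSum ρ B c' v := by
  have hne : ∀ b ∈ B, b ≠ c ∧ b ≠ c' := fun b hb =>
    ⟨fun e => hc (e ▸ hb), fun e => hc' (e ▸ hb)⟩
  have hzero : ∑ p ∈ B.offDiag, ρ (swap c p.1) (ρ (swap c' p.2) v) = 0 := by
    refine sum_involution (fun p _ => p.swap) ?_ ?_ ?_ ?_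
    · rintro ⟨b, b'⟩ hp
      rw [mem_offDiag] at hp
      obtain ⟨hb, hb', hbb⟩ := hp
      have e : v = -(ρ (swap c c' * swap b b') v) := by
        rw [map_mul, Module.End.mul_apply, h b hb b' hb' hbb, map_neg, neg_neg, hv]
      have e2 : ρ (swap c b') (ρ (swap c' b) v) = -(ρ (swap c b) (ρ (swap c' b') v)) := by
        conv_lhs => rw [e]
        rw [map_neg, map_neg, ← Module.End.mul_apply, ← Module.End.mul_apply, ← map_mul,
          ← map_mul, double_swap_mul hbb hcc (hne b hb).1 (hne b hb).2
            (hne b' hb').1 (hne b' hb').2,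
          map_mul, Module.End.mul_apply]
      simp only [Prod.fst_swap, Prod.snd_swap]
      rw [e2, add_neg_cancel]
    · rintro ⟨b, b'⟩ hp _ e
      rw [mem_offDiag] at hp
      exact hp.2.2 (congrArg Prod.fst e).symm
    · rintro ⟨b, b'⟩ hp
      rw [mem_offDiag] at hp ⊢
      exact ⟨hp.2.1, hp.1, hp.2.2.symm⟩
    · rintro ⟨b, b'⟩ _
      rfl
  have hsum : swapSum ρ B c (swapSum ρ B c' v) =
      ∑ p ∈ B ×ˢ B, ρ (swap c p.1) (ρ (swap c' p.2) v) := by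
    simp only [swapSum_apply, map_sum, sum_product]
    rw [sum_comm]
  rw [hsum, ← diag_union_offDiag, sum_union (disjoint_diag_offDiag B), hzero, add_zero, sum_diag,
    swapSum_apply]
  refine sum_congr rfl fun b hb => ?_
  rw [swap_comm c b, swap_comm c' b, ← swap_adjacent (hne b hb).1 hcc.symm, swap_comm c' c, hv]

theorem IsAlt.swapSum_swapSum_self {B : Finset α} {v : V} (h : IsAlt ρ B v) {c : α}
    (hc : c ∉ B) :
    swapSum ρ B c (swapSum ρ B c v) = (#B : ℝ) • v - ((#B : ℝ) - 1) • swapSum ρ B c v := by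
  have key : ∀ b ∈ B, ρ (swap c b) (swapSum ρ B c v) =
      v + ρ (swap c b) v - swapSum ρ B c v := by
    intro b hb
    rw [swapSum_apply, map_sum, ← add_sum_erase _ _ hb, ← add_sum_erase B _ hb,
      swap_self_apply]
    have : ∑ b' ∈ B.erase b, ρ (swap c b) (ρ (swap c b') v) =
        -∑ b' ∈ B.erase b, ρ (swap c b') v := by
      rw [← sum_neg_distrib]
      refine sum_congr rfl fun b' hb' => ?_
      rw [mem_erase] at hb'
      rw [← swap_adjacent (ne_of_mem_of_not_mem hb hc).symm hb'.1, h b' hb'.2 b hb hb'.1, map_neg]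
    rw [this]
    abel
  rw [swapSum_apply (v := swapSum ρ B c v), sum_congr rfl key, sum_sub_distrib,
    sum_add_distrib, ← swapSum_apply, sum_const, sum_const,
    ← Nat.cast_smul_eq_nsmul ℝ, ← Nat.cast_smul_eq_nsmul ℝ, sub_smul, one_smul]
  abel

theorem IsSym.swapSum_crossSum {B C : Finset α} {v : V} {c : α} (h : IsSym ρ (insert c C) v)
    (hc : c ∉ B) (hcC : c ∉ C) (hBC : Disjoint B C) :
    swapSum ρ C c (crossSum ρ B C v) =
      (#C : ℝ) • swapSum ρ B c v + ((#C : ℝ) - 1) • crossSum ρ B C v := by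
  have key : ∀ c' ∈ C, ρ (swap c c') (crossSum ρ B C v) =
      swapSum ρ B c v + crossSum ρ B C v - swapSum ρ B c' v := by
    intro c' hc'
    have hc'B : c' ∉ B := fun e => (disjoint_left.1 hBC e) hc'
    have hv : ρ (swap c c') v = v := h c (mem_insert_self _ _) c' (mem_insert_of_mem hc')
    have hs : ∀ x, swap c c' x ∈ B ↔ x ∈ B := swap_mem_iff_of_notMem hc hc'B
    rw [crossSum_apply, map_sum, ← add_sum_erase _ _ hc', ← add_sum_erase C _ hc',
      apply_swapSum hs, hv, swap_apply_right, sum_congr rfl (fun d hd => ?_)]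
    · abel
    · rw [mem_erase] at hd
      rw [apply_swapSum hs, hv, swap_apply_of_ne_of_ne (ne_of_mem_of_not_mem hd.2 hcC) hd.1]
  rw [swapSum_apply, sum_congr rfl key, sum_sub_distrib, sum_add_distrib,
    ← crossSum_apply, sum_const, sum_const,
    ← Nat.cast_smul_eq_nsmul ℝ, ← Nat.cast_smul_eq_nsmul ℝ, sub_smul, one_smul]
  abel

/-- The full-cycle sum on `B ∪ C` acts on vectors that are alternating on `B` and symmetric on
`C` as a multiple of the cross sum. -/
theorem fullSum_union [Fintype α] {B C : Finset α} {v : V} (hB : B.Nonempty) (hC : C.Nonempty)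
    (hBC : Disjoint B C) (hA : IsAlt ρ B v) (hS : IsSym ρ C v) :
    fullSum ρ (B ∪ C) v =
      ((-1) ^ (#B - 1) * (#B - 1).factorial * (#C - 1).factorial : ℝ) • crossSum ρ B C v := by
  induction hC using Finset.Nonempty.cons_induction with
  | singleton c =>
    have hc : c ∉ B := by simpa using hBC
    rw [union_comm, ← insert_eq, fullSum_insert' hc hB, hA.fullSum_eq_smul hB, map_smul,
      crossSum_apply]
    simp
  | cons c C hc hC ih =>
    rw [cons_eq_insert] at hBC hS ⊢
    obtain ⟨hcB, hBC⟩ := disjoint_insert_right.1 hBC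
    have hc' : c ∉ B ∪ C := by simp [hc, hcB]
    rw [union_insert, fullSum_insert' hc' (hB.mono subset_union_left),
      ih hBC (hS.mono (subset_insert _ _)), map_smul, swapSum_union hBC,
      hS.swapSum_crossSum hcB hc hBC]
    have h1 : swapSum ρ B c (crossSum ρ B C v) = crossSum ρ B C v := by
      rw [crossSum_apply, map_sum]
      refine sum_congr rfl fun d hd => ?_
      exact hA.swapSum_swapSum_of_ne hcB (fun e => disjoint_left.1 hBC e hd)
        (fun e => hc (e ▸ hd)) (hS c (mem_insert_self _ _) d (mem_insert_of_mem hd))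
    have h2 : crossSum ρ B (insert c C) v = swapSum ρ B c v + crossSum ρ B C v := by
      rw [crossSum_apply, sum_insert hc, ← crossSum_apply]
    rw [h1, h2, card_insert_of_notMem hc]
    obtain ⟨m, hm⟩ := Nat.exists_eq_succ_of_ne_zero (card_pos.2 hC).ne'
    rw [hm]
    simp only [Nat.succ_eq_add_one, add_tsub_cancel_right, Nat.factorial_succ]
    push_cast
    module

/-- The quadratic relation for the cross sum. -/
theorem crossSum_crossSum {B C : Finset α} {v : V} (hBC : Disjoint B C)
    (hA : IsAlt ρ B v) (hS : IsSym ρ C v) :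
    crossSum ρ B C (crossSum ρ B C v) =
      ((#C : ℝ) - #B) • crossSum ρ B C v + ((#B : ℝ) * #C) • v := by
  have key : ∀ c ∈ C, swapSum ρ B c (crossSum ρ B C v) =
      (#B : ℝ) • v + crossSum ρ B C v - (#B : ℝ) • swapSum ρ B c v := by
    intro c hc
    have hcB : c ∉ B := fun e => disjoint_left.1 hBC e hc
    rw [crossSum_apply, map_sum, ← add_sum_erase _ _ hc, ← add_sum_erase C _ hc,
      hA.swapSum_swapSum_self hcB, sum_congr rfl (fun d hd => ?_)]
    · rw [sub_smul, one_smul]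
      abel
    · rw [mem_erase] at hd
      exact hA.swapSum_swapSum_of_ne hcB (fun e => disjoint_left.1 hBC e hd.2) hd.1.symm
        (hS c hc d hd.2)
  rw [crossSum_apply (v := crossSum ρ B C v), sum_congr rfl key, sum_sub_distrib, sum_add_distrib,
    ← smul_sum (r := (#B : ℝ)) (f := fun c => swapSum ρ B c v), ← crossSum_apply, sum_const,
    sum_const, ← Nat.cast_smul_eq_nsmul ℝ, ← Nat.cast_smul_eq_nsmul ℝ]
  module

theorem sum_swap_crossSum_erase {B C : Finset α} {i : α} (hiC : i ∉ C)
    (hBC : Disjoint B C) (v : V) :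
    ∑ b ∈ B, ρ (swap i b) (crossSum ρ (B.erase b) C v) =
      swapSum ρ B i (crossSum ρ B C v) - swapSum ρ C i (swapSum ρ B i v) := by
  have h1 : ∑ b ∈ B, ρ (swap i b) (swapSum ρ C b v) = swapSum ρ C i (swapSum ρ B i v) := by
    simp only [swapSum_apply, map_sum]
    refine sum_congr rfl fun b hb => sum_congr rfl fun c hc => ?_
    exact swap_adjacent (ne_of_mem_of_not_mem hc hiC).symm
      (ne_of_mem_of_not_mem hc (disjoint_left.1 hBC hb)).symm v
  rw [← h1, swapSum_apply (v := crossSum ρ B C v), ← sum_sub_distrib]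
  refine sum_congr rfl fun b hb => ?_
  rw [crossSum_erase_left hb, map_sub]

theorem swapSum_crossSum_comm {B C : Finset α} {i : α} (hiB : i ∉ B) (hiC : i ∉ C)
    (hBC : Disjoint B C) (v : V) :
    swapSum ρ B i (crossSum ρ B C v) = crossSum ρ B C (swapSum ρ B i v) +
      swapSum ρ C i (swapSum ρ B i v) - swapSum ρ B i (swapSum ρ C i v) := by
  have key : ∀ c ∈ C, swapSum ρ B i (swapSum ρ B c v) - swapSum ρ B c (swapSum ρ B i v) =
      ρ (swap i c) (swapSum ρ B i v) - swapSum ρ B i (ρ (swap i c) v) := by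
    intro c hc
    have hic : i ≠ c := fun e => hiC (e ▸ hc)
    simp only [swapSum_apply, map_sum]
    rw [sum_comm, ← sum_sub_distrib, ← sum_sub_distrib]
    refine sum_congr rfl fun b hb => ?_
    have hbc : b ≠ c := fun e => disjoint_left.1 hBC hb (e ▸ hc)
    have hbi : b ≠ i := fun e => hiB (e ▸ hb)
    rw [← sum_sub_distrib, sum_eq_single_of_mem b hb]
    · rw [← swap_adjacent hic hbc v, swap_comm b c, swap_comm i b, swap_comm c b,
        swap_adjacent hbc hic]
    · intro b' hb' hne
      have hb'c : b' ≠ c := fun e => disjoint_left.1 hBC hb' (e ▸ hc)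
      have hb'i : b' ≠ i := fun e => hiB (e ▸ hb')
      rw [swap_swap_apply, swap_apply_of_ne_of_ne hic.symm hbc.symm,
        swap_apply_of_ne_of_ne hb'i hne, sub_self]
  have hsum := sum_congr rfl key
  rw [sum_sub_distrib, sum_sub_distrib, ← map_sum, ← map_sum, ← crossSum_apply,
    ← crossSum_apply, ← swapSum_apply, ← swapSum_apply] at hsum
  rw [add_sub_assoc, ← hsum]
  abel

theorem IsAlt.sub_swapSum {B : Finset α} {i : α} {v : V} (h : IsAlt ρ B v) (hi : i ∉ B) :
    IsAlt ρ (insert i B) (v - swapSum ρ B i v) := by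
  have hib : ∀ b ∈ B, ρ (swap i b) (v - swapSum ρ B i v) = -(v - swapSum ρ B i v) := by
    intro b hb
    rw [map_sub, swapSum_apply, map_sum, ← add_sum_erase _ _ hb, ← add_sum_erase B _ hb,
      swap_self_apply]
    have : ∑ b' ∈ B.erase b, ρ (swap i b) (ρ (swap i b') v) =
        -∑ b' ∈ B.erase b, ρ (swap i b') v := by
      rw [← sum_neg_distrib]
      refine sum_congr rfl fun b' hb' => ?_
      rw [mem_erase] at hb'
      rw [← swap_adjacent (ne_of_mem_of_not_mem hb hi).symm hb'.1, h b' hb'.2 b hb hb'.1, map_neg]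
    rw [this]
    abel
  intro x hx y hy hxy
  rcases mem_insert.1 hx with rfl | hxB <;> rcases mem_insert.1 hy with rfl | hyB
  · exact absurd rfl hxy
  · exact hib y hyB
  · rw [swap_comm]; exact hib x hxB
  · rw [map_sub, apply_swapSum (swap_mem_iff_of_mem hxB hyB), h x hxB y hyB hxy,
      swap_apply_of_ne_of_ne (ne_of_mem_of_not_mem hxB hi).symm
        (ne_of_mem_of_not_mem hyB hi).symm, map_neg]
    abel

theorem IsSym.add_swapSum {C : Finset α} {i : α} {v : V} (h : IsSym ρ C v) (hi : i ∉ C) :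
    IsSym ρ (insert i C) (v + swapSum ρ C i v) := by
  have hic : ∀ c ∈ C, ρ (swap i c) (v + swapSum ρ C i v) = v + swapSum ρ C i v := by
    intro c hc
    rw [map_add, swapSum_apply, map_sum, ← add_sum_erase _ _ hc, ← add_sum_erase C _ hc,
      swap_self_apply]
    have : ∑ c' ∈ C.erase c, ρ (swap i c) (ρ (swap i c') v) =
        ∑ c' ∈ C.erase c, ρ (swap i c') v := by
      refine sum_congr rfl fun c' hc' => ?_
      rw [mem_erase] at hc'
      rw [← swap_adjacent (ne_of_mem_of_not_mem hc hi).symm hc'.1, h c' hc'.2 c hc]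
    rw [this]
    abel
  intro x hx y hy
  rcases mem_insert.1 hx with rfl | hxC <;> rcases mem_insert.1 hy with rfl | hyC
  · rw [swap_self]; exact LinearMap.congr_fun (map_one ρ) _
  · exact hic y hyC
  · rw [swap_comm]; exact hic x hxC
  · rw [map_add, apply_swapSum (swap_mem_iff_of_mem hxC hyC), h x hxC y hyC,
      swap_apply_of_ne_of_ne (ne_of_mem_of_not_mem hxC hi).symm (ne_of_mem_of_not_mem hyC hi).symm]

theorem IsSym.swapSum_of_disjoint {B C : Finset α} {i : α} {v : V} (h : IsSym ρ C v) (hi : i ∉ C)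
    (hBC : Disjoint B C) : IsSym ρ C (swapSum ρ B i v) := by
  intro x hx y hy
  rw [apply_swapSum (swap_mem_iff_of_notMem (disjoint_right.1 hBC hx) (disjoint_right.1 hBC hy)),
    h x hx y hy, swap_apply_of_ne_of_ne (ne_of_mem_of_not_mem hx hi).symm
      (ne_of_mem_of_not_mem hy hi).symm]

theorem IsAlt.swapSum_of_disjoint {B C : Finset α} {i : α} {v : V} (h : IsAlt ρ B v) (hi : i ∉ B)
    (hBC : Disjoint B C) : IsAlt ρ B (swapSum ρ C i v) := by
  intro x hx y hy hxy
  rw [apply_swapSum (swap_mem_iff_of_notMem (disjoint_left.1 hBC hx) (disjoint_left.1 hBC hy)),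
    h x hx y hy hxy, swap_apply_of_ne_of_ne (ne_of_mem_of_not_mem hx hi).symm
      (ne_of_mem_of_not_mem hy hi).symm, map_neg]

theorem IsAlt.sub {B : Finset α} {v w : V} (hv : IsAlt ρ B v) (hw : IsAlt ρ B w) :
    IsAlt ρ B (v - w) := fun x hx y hy hxy => by
  rw [map_sub, hv x hx y hy hxy, hw x hx y hy hxy]; abel

theorem IsAlt.add {B : Finset α} {v w : V} (hv : IsAlt ρ B v) (hw : IsAlt ρ B w) :
    IsAlt ρ B (v + w) := fun x hx y hy hxy => by
  rw [map_add, hv x hx y hy hxy, hw x hx y hy hxy]; abel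

theorem IsSym.sub {C : Finset α} {v w : V} (hv : IsSym ρ C v) (hw : IsSym ρ C w) :
    IsSym ρ C (v - w) := fun x hx y hy => by
  rw [map_sub, hv x hx y hy, hw x hx y hy]

theorem sum_crossSum_erase_left {B C : Finset α} (v : V) :
    ∑ b ∈ B, crossSum ρ (B.erase b) C v = ((#B : ℝ) - 1) • crossSum ρ B C v := by
  rw [sum_congr rfl fun b hb => crossSum_erase_left hb v, sum_sub_distrib, sum_const,
    ← crossSum_apply, crossSum_comm, ← Nat.cast_smul_eq_nsmul ℝ, sub_smul, one_smul]

theorem sum_crossSum_erase_right {B C : Finset α} (v : V) :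
    ∑ c ∈ C, crossSum ρ B (C.erase c) v = ((#C : ℝ) - 1) • crossSum ρ B C v := by
  rw [sum_congr rfl fun b hb => crossSum_erase_right hb v, sum_sub_distrib, sum_const,
    ← crossSum_apply, ← Nat.cast_smul_eq_nsmul ℝ, sub_smul, one_smul]

theorem sum_swap_crossSum_erase_right {B C : Finset α} {i : α} (hiB : i ∉ B)
    (hBC : Disjoint B C) (v : V) :
    ∑ c ∈ C, ρ (swap i c) (crossSum ρ B (C.erase c) v) =
      swapSum ρ C i (crossSum ρ B C v) - swapSum ρ B i (swapSum ρ C i v) := by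
  rw [← crossSum_comm, ← sum_swap_crossSum_erase hiB hBC.symm]
  simp only [crossSum_comm]

theorem swapSum_crossSum_of_eq {B C : Finset α} {i : α} {v : V} (hiB : i ∉ B)
    (hiC : i ∉ C) (hBC : Disjoint B C)
    (hX : swapSum ρ B i v = v) (hY : swapSum ρ C i v = -v) :
    swapSum ρ B i (crossSum ρ B C v) = crossSum ρ B C v := by
  rw [swapSum_crossSum_comm hiB hiC hBC, hX, hY, map_neg, hX]
  abel

theorem swapSum_crossSum_of_eq_neg {B C : Finset α} {i : α} {v : V} (hiB : i ∉ B)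
    (hiC : i ∉ C) (hBC : Disjoint B C)
    (hX : swapSum ρ B i v = v) (hY : swapSum ρ C i v = -v) :
    swapSum ρ C i (crossSum ρ B C v) = -crossSum ρ B C v := by
  rw [← crossSum_comm, swapSum_crossSum_comm hiC hiB hBC.symm, hX, hY, map_neg, map_neg, hX]
  abel

theorem swapSum_mem {S T : Finset α} {i : α} (hTS : T ⊆ S) {E : Submodule ℝ V}
    (hE : ∀ x ∈ S, ∀ y ∈ S, ∀ w ∈ E, ρ (swap x y) w ∈ E) (hi : i ∈ S) {w : V} (hw : w ∈ E) :
    swapSum ρ T i w ∈ E := by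
  rw [swapSum_apply]
  exact sum_mem fun t ht => hE i hi t (hTS ht) w hw

theorem eq_or_eq_of_crossSum_eq_smul {B C : Finset α} {v : V} (hBC : Disjoint B C)
    (hA : IsAlt ρ B v) (hS : IsSym ρ C v) (hv : v ≠ 0) {ζ : ℝ}
    (hζ : crossSum ρ B C v = ζ • v) : ζ = -(#B : ℝ) ∨ ζ = (#C : ℝ) := by
  have h := crossSum_crossSum hBC hA hS
  rw [hζ, map_smul, hζ, smul_smul, smul_smul, ← add_smul] at h
  have h' := smul_left_injective ℝ hv h
  have : (ζ + #B) * (ζ - #C) = 0 := by linear_combination h'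
  rcases mul_eq_zero.1 this with h | h
  · left; linarith
  · right; linarith

/-! ### Eigenvalues of the sum of all `(n-1)`-cycles -/

section NearFullSum

variable [Fintype α]

/-- The action of the sum of all `(n-1)`-cycles. -/
noncomputable def nearFullSum (ρ : Perm α →* Module.End ℝ V) : Module.End ℝ V :=
  ∑ j, fullSum ρ (univ.erase j)

theorem nearFullSum_apply (v : V) :
    nearFullSum ρ v = ∑ j, fullSum ρ (univ.erase j) v := by
  rw [nearFullSum, LinearMap.sum_apply]

theorem apply_nearFullSum (g : Perm α) (v : V) :
    ρ g (nearFullSum ρ v) = nearFullSum ρ (ρ g v) := by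
  rw [nearFullSum_apply, nearFullSum_apply, map_sum]
  exact Fintype.sum_equiv g _ _ fun j => apply_fullSum (by simp) v

/-! ### Hook-type vectors -/

variable {B C : Finset α} {v : V}

theorem sum_fullSum_hook_left (hBC : Disjoint B C) (hA : IsAlt ρ B v) (hS : IsSym ρ C v)
    {k : ℕ} (hk : #B = k + 2) (hC : C.Nonempty) :
    ∑ b ∈ B, fullSum ρ (B.erase b ∪ C) v =
      ((-1) ^ k * k.factorial * (#C - 1).factorial * (k + 1) : ℝ) • crossSum ρ B C v := by
  have key : ∀ b ∈ B, fullSum ρ (B.erase b ∪ C) v =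
      ((-1) ^ k * k.factorial * (#C - 1).factorial : ℝ) • crossSum ρ (B.erase b) C v := by
    intro b hb
    have hc : #(B.erase b) = k + 1 := by rw [card_erase_of_mem hb, hk]; rfl
    rw [fullSum_union (card_pos.1 (by omega)) hC (hBC.mono_left (erase_subset _ _))
      (hA.mono (erase_subset _ _)) hS, hc, Nat.add_sub_cancel]
  rw [sum_congr rfl key, ← smul_sum, sum_crossSum_erase_left, smul_smul, hk]
  push_cast
  congr 1
  ring

theorem sum_fullSum_hook_right (hBC : Disjoint B C) (hA : IsAlt ρ B v) (hS : IsSym ρ C v)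
    {l : ℕ} (hl : #C = l + 2) (hB : B.Nonempty) :
    ∑ c ∈ C, fullSum ρ (B ∪ C.erase c) v =
      ((-1) ^ (#B - 1) * (#B - 1).factorial * l.factorial * (l + 1) : ℝ) •
        crossSum ρ B C v := by
  have key : ∀ c ∈ C, fullSum ρ (B ∪ C.erase c) v =
      ((-1) ^ (#B - 1) * (#B - 1).factorial * l.factorial : ℝ) •
        crossSum ρ B (C.erase c) v := by
    intro c hc
    have hc : #(C.erase c) = l + 1 := by rw [card_erase_of_mem hc, hl]; rfl
    rw [fullSum_union hB (card_pos.1 (by omega)) (hBC.mono_right (erase_subset _ _))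
      hA (hS.mono (erase_subset _ _)), hc, Nat.add_sub_cancel]
  rw [sum_congr rfl key, ← smul_sum, sum_crossSum_erase_right, smul_smul, hl]
  push_cast
  congr 1
  ring

theorem nearFullSum_apply_of_union (hBC : Disjoint B C) (hU : B ∪ C = univ) (v : V) :
    nearFullSum ρ v = ∑ b ∈ B, fullSum ρ (B.erase b ∪ C) v +
      ∑ c ∈ C, fullSum ρ (B ∪ C.erase c) v := by
  rw [nearFullSum_apply, ← hU, sum_union hBC]
  congr 1
  · refine sum_congr rfl fun b hb => ?_
    rw [erase_union_distrib, erase_eq_of_notMem (disjoint_left.1 hBC hb)]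
  · refine sum_congr rfl fun c hc => ?_
    rw [erase_union_distrib, erase_eq_of_notMem (disjoint_right.1 hBC hc)]

theorem nearFullSum_of_isSym (h : IsSym ρ univ v) (hn : 2 ≤ Fintype.card α) :
    nearFullSum ρ v =
      (Fintype.card α * (Fintype.card α - 2).factorial : ℝ) • v := by
  have key : ∀ j ∈ (univ : Finset α), fullSum ρ (univ.erase j) v =
      ((Fintype.card α - 2).factorial : ℝ) • v := by
    intro j hj
    have hc : #(univ.erase j) = Fintype.card α - 1 := card_erase_of_mem hj
    rw [(h.mono (erase_subset j univ)).fullSum_eq_smul (card_pos.1 (by omega)), hc]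
    rfl
  rw [nearFullSum_apply, sum_congr rfl key, sum_const, card_univ, ← Nat.cast_smul_eq_nsmul ℝ,
    smul_smul]

theorem nearFullSum_of_isAlt (h : IsAlt ρ univ v) (hn : 2 ≤ Fintype.card α) :
    nearFullSum ρ v = ((-1) ^ Fintype.card α *
      (Fintype.card α * (Fintype.card α - 2).factorial) : ℝ) • v := by
  have key : ∀ j ∈ (univ : Finset α), fullSum ρ (univ.erase j) v =
      ((-1) ^ Fintype.card α * (Fintype.card α - 2).factorial : ℝ) • v := by
    intro j hj
    have hc : #(univ.erase j) = Fintype.card α - 1 := card_erase_of_mem hj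
    rw [(h.mono (erase_subset j univ)).fullSum_eq_smul (card_pos.1 (by omega)), hc]
    obtain ⟨m, hm⟩ := Nat.exists_eq_add_of_le' hn
    rw [hm]
    simp [pow_succ]
  rw [nearFullSum_apply, sum_congr rfl key, sum_const, card_univ, ← Nat.cast_smul_eq_nsmul ℝ,
    smul_smul]
  congr 1
  ring

theorem eigenvalue_of_hook (hBC : Disjoint B C) (hU : B ∪ C = univ) (hA : IsAlt ρ B v)
    (hS : IsSym ρ C v) (hv : v ≠ 0) (hn : 3 ≤ Fintype.card α) {θ : ℝ} (hθ : θ ≠ 0)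
    (h : nearFullSum ρ v = θ • v) :
    θ = Fintype.card α * (Fintype.card α - 2).factorial ∨
      θ = (-1) ^ Fintype.card α * (Fintype.card α * (Fintype.card α - 2).factorial) := by
  have hcard : Fintype.card α = #B + #C := by
    rw [← card_union_of_disjoint hBC, hU, card_univ]
  rcases B.eq_empty_or_nonempty with rfl | hB
  · rw [empty_union] at hU
    subst hU
    left
    rw [nearFullSum_of_isSym hS (by omega)] at h
    exact (smul_left_injective ℝ hv h).symm
  rcases C.eq_empty_or_nonempty with rfl | hC
  · rw [union_empty] at hU
    subst hU
    right
    rw [nearFullSum_of_isAlt hA (by omega)] at h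
    exact (smul_left_injective ℝ hv h).symm
  rw [nearFullSum_apply_of_union hBC hU] at h
  have hB1 : 1 ≤ #B := card_pos.2 hB
  have hC1 : 1 ≤ #C := card_pos.2 hC
  rcases hB1.eq_or_lt with hB1 | hB2
  · obtain ⟨l, hl⟩ := Nat.exists_eq_add_of_le' (show 2 ≤ #C by omega)
    obtain ⟨b, rfl⟩ := card_eq_one.1 hB1.symm
    rw [sum_fullSum_hook_right hBC hA hS hl hB, sum_singleton, erase_singleton, empty_union,
      hS.fullSum_eq_smul hC, hl] at h
    simp only [card_singleton, Nat.reduceSub, pow_zero, Nat.factorial_zero, Nat.cast_one, one_mul,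
      show l + 2 - 1 = l + 1 from rfl, Nat.factorial_succ l] at h
    push_cast at h
    have hf : ((l + 1) * l.factorial : ℝ) ≠ 0 := by positivity
    have hZ : crossSum ρ {b} C v = (θ / ((l + 1) * l.factorial) - 1) • v := by
      rw [sub_smul, div_eq_inv_mul, mul_smul, ← h, smul_add, smul_smul, smul_smul,
        mul_comm (l.factorial : ℝ), inv_mul_cancel₀ hf]
      module
    rcases eq_or_eq_of_crossSum_eq_smul hBC hA hS hv hZ with h' | h'
    · field_simp at h'
      simp at h'
      exact absurd h' hθ
    · left
      rw [hcard, ← hB1, hl] at *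
      field_simp at h'
      rw [show 1 + (l + 2) - 2 = l + 1 by omega, Nat.factorial_succ]
      push_cast at h' ⊢
      linarith
  · obtain ⟨k, hk⟩ := Nat.exists_eq_add_of_le' hB2
    rcases hC1.eq_or_lt with hC1 | hC2
    · obtain ⟨c, rfl⟩ := card_eq_one.1 hC1.symm
      rw [sum_fullSum_hook_left hBC hA hS hk hC, sum_singleton, erase_singleton, union_empty,
        hA.fullSum_eq_smul hB, hk] at h
      simp only [card_singleton, Nat.reduceSub, Nat.factorial_zero, Nat.cast_one, mul_one,
        show k + 2 - 1 = k + 1 from rfl, Nat.factorial_succ k, pow_succ] at h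
      push_cast at h
      have hs : ((-1 : ℝ) ^ k) * (-1) ^ k = 1 := by rw [← mul_pow]; simp
      have hf : ((k + 1) * k.factorial : ℝ) ≠ 0 := by positivity
      have hf' : ((-1) ^ k * ((k + 1) * k.factorial) : ℝ) ≠ 0 := mul_ne_zero (by simp) hf
      have hZ : crossSum ρ B {c} v =
          (θ / ((-1) ^ k * ((k + 1) * k.factorial)) + 1) • v := by
        rw [add_smul, div_eq_inv_mul, mul_smul, ← h, smul_add, smul_smul, smul_smul,
          show ((-1) ^ k * k.factorial * (k + 1) : ℝ) = (-1) ^ k * ((k + 1) * k.factorial) by ring,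
          show ((-1) ^ k * -1 * ((k + 1) * k.factorial) : ℝ) =
            -((-1) ^ k * ((k + 1) * k.factorial)) by ring, mul_neg,
          inv_mul_cancel₀ hf']
        module
      rcases eq_or_eq_of_crossSum_eq_smul hBC hA hS hv hZ with h' | h'
      · right
        rw [hcard, ← hC1, hk] at *
        rw [show k + 2 + 1 - 2 = k + 1 by omega, Nat.factorial_succ]
        have h'' : θ / ((-1) ^ k * ((k + 1) * k.factorial)) = -(((k + 2 : ℕ) : ℝ) + 1) := by
          linarith
        rw [div_eq_iff hf'] at h''
        rw [h'']
        push_cast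
        ring
      · have h'' : θ / ((-1) ^ k * ((k + 1) * k.factorial)) = 0 := by simpa using h'
        rw [div_eq_zero_iff] at h''
        tauto
    · obtain ⟨l, hl⟩ := Nat.exists_eq_add_of_le' hC2
      rw [sum_fullSum_hook_left hBC hA hS hk hC, sum_fullSum_hook_right hBC hA hS hl hB, hk, hl,
        ← add_smul] at h
      simp only [show k + 2 - 1 = k + 1 from rfl, show l + 2 - 1 = l + 1 from rfl,
        Nat.factorial_succ, pow_succ] at h
      push_cast at h
      have : θ • v = 0 := by
        rw [← h]
        convert zero_smul ℝ _ using 2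
        ring
      exact absurd this (smul_ne_zero hθ hv)

/-! ### Vectors on which the extra transposition sums act by `1` and `-1` -/

variable {i : α}

theorem sum_fullSum_twist_left (hiB : i ∉ B) (hiC : i ∉ C) (hBC : Disjoint B C)
    (hA : IsAlt ρ B v) (hS : IsSym ρ C v)
    (hX : swapSum ρ B i v = v) (hY : swapSum ρ C i v = -v)
    {k : ℕ} (hk : #B = k + 2) (hC : C.Nonempty) :
    ∑ b ∈ B, fullSum ρ (insert i (B.erase b ∪ C)) v =
      (-((-1) ^ k * k.factorial * (#C - 1).factorial) : ℝ) • (crossSum ρ B C v + v) := by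
  have key : ∀ b ∈ B, fullSum ρ (insert i (B.erase b ∪ C)) v =
      ((-1) ^ k * k.factorial * (#C - 1).factorial : ℝ) •
        (swapSum ρ B i (crossSum ρ (B.erase b) C v) + swapSum ρ C i (crossSum ρ (B.erase b) C v)
          - ρ (swap i b) (crossSum ρ (B.erase b) C v)) := by
    intro b hb
    have hc : #(B.erase b) = k + 1 := by rw [card_erase_of_mem hb, hk]; rfl
    have hd : Disjoint (B.erase b) C := hBC.mono_left (erase_subset _ _)
    have hi : i ∉ B.erase b ∪ C := by simp [hiB, hiC]
    rw [fullSum_insert' hi (hC.mono subset_union_right), fullSum_union (card_pos.1 (by omega)) hC hd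
      (hA.mono (erase_subset _ _)) hS, hc, Nat.add_sub_cancel, map_smul, swapSum_union hd,
      swapSum_erase hb]
    congr 1
    abel
  rw [sum_congr rfl key, ← smul_sum, sum_sub_distrib, sum_add_distrib, ← map_sum, ← map_sum,
    sum_crossSum_erase_left, sum_swap_crossSum_erase hiC hBC, map_smul, map_smul,
    swapSum_crossSum_of_eq hiB hiC hBC hX hY, swapSum_crossSum_of_eq_neg hiB hiC hBC hX hY, hX, hY]
  module

theorem sum_fullSum_twist_right (hiB : i ∉ B) (hiC : i ∉ C) (hBC : Disjoint B C)
    (hA : IsAlt ρ B v) (hS : IsSym ρ C v)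
    (hX : swapSum ρ B i v = v) (hY : swapSum ρ C i v = -v)
    {l : ℕ} (hl : #C = l + 2) (hB : B.Nonempty) :
    ∑ c ∈ C, fullSum ρ (insert i (B ∪ C.erase c)) v =
      ((-1) ^ (#B - 1) * (#B - 1).factorial * l.factorial : ℝ) • (crossSum ρ B C v - v) := by
  have key : ∀ c ∈ C, fullSum ρ (insert i (B ∪ C.erase c)) v =
      ((-1) ^ (#B - 1) * (#B - 1).factorial * l.factorial : ℝ) •
        (swapSum ρ B i (crossSum ρ B (C.erase c) v) + swapSum ρ C i (crossSum ρ B (C.erase c) v)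
          - ρ (swap i c) (crossSum ρ B (C.erase c) v)) := by
    intro c hc
    have hcard : #(C.erase c) = l + 1 := by rw [card_erase_of_mem hc, hl]; rfl
    have hd : Disjoint B (C.erase c) := hBC.mono_right (erase_subset _ _)
    have hi : i ∉ B ∪ C.erase c := by simp [hiB, hiC]
    rw [fullSum_insert' hi (hB.mono subset_union_left), fullSum_union hB (card_pos.1 (by omega)) hd
      hA (hS.mono (erase_subset _ _)), hcard, Nat.add_sub_cancel, map_smul, swapSum_union hd,
      swapSum_erase hc]
    congr 1
    abel
  rw [sum_congr rfl key, ← smul_sum, sum_sub_distrib, sum_add_distrib, ← map_sum, ← map_sum,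
    sum_crossSum_erase_right, sum_swap_crossSum_erase_right hiB hBC, map_smul, map_smul,
    swapSum_crossSum_of_eq hiB hiC hBC hX hY, swapSum_crossSum_of_eq_neg hiB hiC hBC hX hY, hY,
    map_neg, hX]
  module

theorem nearFullSum_apply_of_insert (hiB : i ∉ B) (hiC : i ∉ C) (hBC : Disjoint B C)
    (hU : insert i (B ∪ C) = univ) (v : V) :
    nearFullSum ρ v = fullSum ρ (B ∪ C) v + (∑ b ∈ B, fullSum ρ (insert i (B.erase b ∪ C)) v +
      ∑ c ∈ C, fullSum ρ (insert i (B ∪ C.erase c)) v) := by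
  have hi : i ∉ B ∪ C := by simp [hiB, hiC]
  rw [nearFullSum_apply, ← hU, sum_insert hi, sum_union hBC, erase_insert hi]
  congr 2
  · refine sum_congr rfl fun b hb => ?_
    rw [erase_insert_of_ne (ne_of_mem_of_not_mem hb hiB).symm, erase_union_distrib,
      erase_eq_of_notMem (disjoint_left.1 hBC hb)]
  · refine sum_congr rfl fun c hc => ?_
    rw [erase_insert_of_ne (ne_of_mem_of_not_mem hc hiC).symm, erase_union_distrib,
      erase_eq_of_notMem (disjoint_right.1 hBC hc)]

theorem nearFullSum_of_twist (hiB : i ∉ B) (hiC : i ∉ C) (hBC : Disjoint B C)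
    (hU : insert i (B ∪ C) = univ) (hA : IsAlt ρ B v) (hS : IsSym ρ C v)
    (hX : swapSum ρ B i v = v) (hY : swapSum ρ C i v = -v)
    {k l : ℕ} (hk : #B = k + 2) (hl : #C = l + 2) :
    nearFullSum ρ v = (-((-1) ^ k * k.factorial * l.factorial) : ℝ) •
      (((k + 1) * (l + 1) : ℝ) • crossSum ρ B C v + (l + 1 : ℝ) • (crossSum ρ B C v + v) +
        (k + 1 : ℝ) • (crossSum ρ B C v - v)) := by
  have hB : B.Nonempty := card_pos.1 (by omega)
  have hC : C.Nonempty := card_pos.1 (by omega)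
  rw [nearFullSum_apply_of_insert hiB hiC hBC hU, fullSum_union hB hC hBC hA hS,
    sum_fullSum_twist_left hiB hiC hBC hA hS hX hY hk hC,
    sum_fullSum_twist_right hiB hiC hBC hA hS hX hY hl hB, hk, hl]
  simp only [show k + 2 - 1 = k + 1 from rfl, show l + 2 - 1 = l + 1 from rfl,
    Nat.factorial_succ, pow_succ]
  push_cast
  module

/-- The nonnegative weight `p! (p + 2)` out of which the small eigenvalues are built. -/
def twistWeight (p : ℕ) : ℕ := p.factorial * (p + 2)

theorem eigenvalue_of_twist (hiB : i ∉ B) (hiC : i ∉ C) (hBC : Disjoint B C)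
    (hU : insert i (B ∪ C) = univ) (hA : IsAlt ρ B v) (hS : IsSym ρ C v)
    (hX : swapSum ρ B i v = v) (hY : swapSum ρ C i v = -v) (hv : v ≠ 0)
    (hn : 4 ≤ Fintype.card α) {θ : ℝ} (h : nearFullSum ρ v = θ • v) :
    ∃ p q, p + q + 4 = Fintype.card α ∧ θ = (-1) ^ (p + 1) * twistWeight p * twistWeight q := by
  have hcard : Fintype.card α = #B + #C + 1 := by
    rw [← card_univ, ← hU, card_insert_of_notMem (by simp [hiB, hiC]), card_union_of_disjoint hBC]
  have hB : B.Nonempty := by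
    rw [nonempty_iff_ne_empty]
    rintro rfl
    exact hv (by rw [← hX, swapSum_apply, sum_empty])
  have hC : C.Nonempty := by
    rw [nonempty_iff_ne_empty]
    rintro rfl
    exact hv (by rw [← neg_eq_zero, ← hY, swapSum_apply, sum_empty])
  have hB1 : 1 ≤ #B := card_pos.2 hB
  have hC1 : 1 ≤ #C := card_pos.2 hC
  rcases hB1.eq_or_lt with hB1 | hB2
  · obtain ⟨l, hl⟩ := Nat.exists_eq_add_of_le' (show 2 ≤ #C by omega)
    have hR := sum_fullSum_twist_right hiB hiC hBC hA hS hX hY hl hB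
    obtain ⟨b, rfl⟩ := card_eq_one.1 hB1.symm
    have hX' : ρ (swap i b) v = v := by simpa [swapSum_apply] using hX
    have hbC : b ∉ C := by simpa using hBC
    have hZ : crossSum ρ {b} C v = -v := by
      have := apply_swapSum (ρ := ρ) (swap_mem_iff_of_notMem hiC hbC) i v
      rw [hY, map_neg, hX', swap_apply_left] at this
      rw [← crossSum_comm, crossSum_apply, sum_singleton, ← this]
    rw [nearFullSum_apply_of_insert hiB hiC hBC hU, hR, fullSum_union hB hC hBC hA hS,
      sum_singleton, erase_singleton, empty_union, fullSum_insert' hiC hC, hS.fullSum_eq_smul hC,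
      map_smul, hY, hZ, hl] at h
    have h' : (-2 * twistWeight l : ℝ) • v = θ • v := by
      rw [← h]
      simp only [twistWeight, show l + 2 - 1 = l + 1 from rfl, Nat.factorial_succ, card_singleton,
        Nat.sub_self, pow_zero, Nat.factorial_zero]
      push_cast
      module
    refine ⟨0, l, by rw [hcard, hl, card_singleton]; omega, ?_⟩
    rw [← smul_left_injective ℝ hv h']
    norm_num [twistWeight]
  · obtain ⟨k, hk⟩ := Nat.exists_eq_add_of_le' hB2
    rcases hC1.eq_or_lt with hC1 | hC2
    · have hL := sum_fullSum_twist_left hiB hiC hBC hA hS hX hY hk hC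
      obtain ⟨c, rfl⟩ := card_eq_one.1 hC1.symm
      have hY' : ρ (swap i c) v = -v := by simpa [swapSum_apply] using hY
      have hcB : c ∉ B := by simpa using hBC
      have hZ : crossSum ρ B {c} v = v := by
        have := apply_swapSum (ρ := ρ) (swap_mem_iff_of_notMem hiB hcB) i v
        rw [hX, hY', swap_apply_left, map_neg, neg_inj] at this
        rw [crossSum_apply, sum_singleton, ← this]
      rw [nearFullSum_apply_of_insert hiB hiC hBC hU, hL, fullSum_union hB hC hBC hA hS,
        sum_singleton, erase_singleton, union_empty, fullSum_insert' hiB hB, hA.fullSum_eq_smul hB,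
        map_smul, hX, hZ, hk] at h
      have h' : ((-1) ^ (k + 1) * 2 * twistWeight k : ℝ) • v = θ • v := by
        rw [← h]
        simp only [twistWeight, show k + 2 - 1 = k + 1 from rfl, Nat.factorial_succ, card_singleton,
          Nat.sub_self, Nat.factorial_zero, pow_succ]
        push_cast
        module
      refine ⟨k, 0, by rw [hcard, hk, card_singleton], ?_⟩
      rw [← smul_left_injective ℝ hv h']
      simp [twistWeight]
      ring
    · obtain ⟨l, hl⟩ := Nat.exists_eq_add_of_le' hC2
      have hK := nearFullSum_of_twist hiB hiC hBC hU hA hS hX hY hk hl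
      set c : ℝ := -((-1) ^ k * k.factorial * l.factorial) with hc
      have hc0 : c ≠ 0 := by
        rw [hc]
        exact neg_ne_zero.2 (mul_ne_zero (mul_ne_zero (by simp) (by positivity)) (by positivity))
      have ha : ((k + 1) * (l + 1) + (l + 1) + (k + 1) : ℝ) ≠ 0 := by positivity
      have hZ : crossSum ρ B C v =
          (((k + 1) * (l + 1) + (l + 1) + (k + 1) : ℝ)⁻¹ * (c⁻¹ * θ - (l - k))) • v := by
        rw [mul_smul, sub_smul, mul_smul, ← h, hK, inv_smul_smul₀ hc0, eq_inv_smul_iff₀ ha]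
        module
      rw [h] at hK
      rcases eq_or_eq_of_crossSum_eq_smul hBC hA hS hv hZ with h' | h'
      · rw [hZ, h', hk] at hK
        have h'' : θ • v = ((-1) ^ (k + 1 + 1) * twistWeight (k + 1) * twistWeight l : ℝ) • v := by
          rw [hK, hc]
          simp only [twistWeight, Nat.factorial_succ, pow_succ]
          push_cast
          module
        exact ⟨k + 1, l, by rw [hcard, hk, hl]; omega, smul_left_injective ℝ hv h''⟩
      · rw [hZ, h', hl] at hK
        have h'' : θ • v = ((-1) ^ (k + 1) * twistWeight k * twistWeight (l + 1) : ℝ) • v := by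
          rw [hK, hc]
          simp only [twistWeight, Nat.factorial_succ, pow_succ]
          push_cast
          module
        exact ⟨k, l + 1, by rw [hcard, hk, hl]; omega, smul_left_injective ℝ hv h''⟩

/-! ### Mixed vectors inside a submodule -/

theorem fullSum_mem {S : Finset α} (hS : S.Nonempty) {E : Submodule ℝ V}
    (hE : ∀ x ∈ S, ∀ y ∈ S, ∀ w ∈ E, ρ (swap x y) w ∈ E) {w : V} (hw : w ∈ E) :
    fullSum ρ S w ∈ E := by
  induction hS using Finset.Nonempty.cons_induction with
  | singleton x => rwa [fullSum_singleton]
  | cons i S hi hS ih =>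
    rw [cons_eq_insert] at hE ⊢
    rw [fullSum_insert' hi hS]
    exact swapSum_mem (subset_insert _ _) hE (mem_insert_self _ _) (ih fun x hx y hy =>
      hE x (mem_insert_of_mem hx) y (mem_insert_of_mem hy))

/-- If the full-cycle sum on `S` does not kill a submodule stable under the transpositions of `S`,
then this submodule has a vector alternating on one part of `S` and symmetric on the other. -/
theorem exists_isAlt_isSym
    (hsem : ∀ (T : Finset α) (v : V), fullSum ρ T (fullSum ρ T v) = 0 → fullSum ρ T v = 0)
    {S : Finset α} (hS : S.Nonempty) (E : Submodule ℝ V)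
    (hE : ∀ x ∈ S, ∀ y ∈ S, ∀ w ∈ E, ρ (swap x y) w ∈ E) {w₀ : V} (hw₀ : w₀ ∈ E)
    (hL : fullSum ρ S w₀ ≠ 0) :
    ∃ (B C : Finset α) (w : V), Disjoint B C ∧ B ∪ C = S ∧ w ∈ E ∧ w ≠ 0 ∧
      IsAlt ρ B w ∧ IsSym ρ C w := by
  induction hS using Finset.Nonempty.cons_induction generalizing E w₀ with
  | singleton x =>
    rw [fullSum_singleton] at hL
    refine ⟨{x}, ∅, w₀, by simp, by simp, hw₀, hL, ?_, by simp [IsSym]⟩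
    intro a ha b hb hab
    rw [mem_singleton] at ha hb
    exact absurd (ha.trans hb.symm) hab
  | cons i S hi hS ih =>
    rw [cons_eq_insert] at hE hL ⊢
    have hL' : ∀ w, fullSum ρ (insert i S) w ≠ 0 →
        fullSum ρ S (fullSum ρ (insert i S) w) ≠ 0 := by
      intro w hw h0
      refine hw (hsem _ _ ?_)
      rw [fullSum_insert' hi hS, h0, map_zero]
    obtain ⟨B, C, w, hBC, hU, hwE, hw, hA, hC⟩ := ih (E.map (fullSum ρ (insert i S))) (by
      rintro x hx y hy _ ⟨w, hw, rfl⟩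
      refine ⟨ρ (swap x y) w, hE x (mem_insert_of_mem hx) y (mem_insert_of_mem hy) w hw, ?_⟩
      exact (apply_fullSum
        (swap_mem_iff_of_mem (mem_insert_of_mem hx) (mem_insert_of_mem hy)) w).symm)
      ⟨w₀, hw₀, rfl⟩ (hL' _ hL)
    obtain ⟨w', hw', rfl⟩ := hwE
    have hmem : fullSum ρ (insert i S) w' ∈ E := fullSum_mem (insert_nonempty _ _) hE hw'
    have hJ : swapSum ρ S i (fullSum ρ (insert i S) w') ≠ 0 := by
      intro h0
      refine hw (hsem _ _ ?_)
      rw [fullSum_insert hi hS, h0, map_zero]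
    subst hU
    set w := fullSum ρ (insert i (B ∪ C)) w'
    have hiB : i ∉ B := fun h => hi (mem_union_left _ h)
    have hiC : i ∉ C := fun h => hi (mem_union_right _ h)
    by_cases hX : w - swapSum ρ B i w = 0
    · refine ⟨B, insert i C, w + swapSum ρ C i w, by simp [hiB, hBC], by simp,
        E.add_mem hmem (swapSum_mem (by grind) hE (mem_insert_self _ _) hmem), ?_,
        hA.add (hA.swapSum_of_disjoint hiB hBC), hC.add_swapSum hiC⟩
      rw [swapSum_union hBC, ← sub_eq_zero.1 hX] at hJ
      exact hJ
    · exact ⟨insert i B, C, w - swapSum ρ B i w, by simp [hiC, hBC], by simp,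
        E.sub_mem hmem (swapSum_mem (by grind) hE (mem_insert_self _ _) hmem), hX,
        hA.sub_swapSum hiB, hC.sub (hC.swapSum_of_disjoint hiC hBC)⟩

/-- The nonzero eigenvalues of the sum of all `(n-1)`-cycles. -/
theorem eigenvalue_nearFullSum
    (hsem : ∀ (T : Finset α) (v : V), fullSum ρ T (fullSum ρ T v) = 0 → fullSum ρ T v = 0)
    (hn : 4 ≤ Fintype.card α) {θ : ℝ} (hθ : θ ≠ 0) (hv : v ≠ 0) (h : nearFullSum ρ v = θ • v) :
    θ = Fintype.card α * (Fintype.card α - 2).factorial ∨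
      θ = (-1) ^ Fintype.card α * (Fintype.card α * (Fintype.card α - 2).factorial) ∨
      ∃ p q, p + q + 4 = Fintype.card α ∧
        θ = (-1) ^ (p + 1) * twistWeight p * twistWeight q := by
  obtain ⟨i, hi⟩ : ∃ i, fullSum ρ (univ.erase i) v ≠ 0 := by
    by_contra! h0
    rw [nearFullSum_apply, sum_eq_zero fun j _ => h0 j] at h
    exact smul_ne_zero hθ hv h.symm
  have hcard : #(univ.erase i) = Fintype.card α - 1 := card_erase_of_mem (mem_univ i)
  let E : Submodule ℝ V := LinearMap.ker (nearFullSum ρ - θ • 1)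
  have hE : ∀ w, w ∈ E ↔ nearFullSum ρ w = θ • w := fun w => by
    simp [E, sub_eq_zero]
  have hEg : ∀ (g : Perm α) (w : V), w ∈ E → ρ g w ∈ E := by
    intro g w hw
    rw [hE] at hw ⊢
    rw [← apply_nearFullSum, hw, map_smul]
  obtain ⟨B, C, w, hBC, hU, hwE, hw, hA, hS⟩ := exists_isAlt_isSym hsem
    (card_pos.1 (by omega)) E (fun x _ y _ w hw => hEg _ w hw) ((hE v).2 h) hi
  have hiU : i ∉ B ∪ C := by rw [hU]; exact notMem_erase _ _
  have hiB : i ∉ B := fun h => hiU (mem_union_left _ h)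
  have hiC : i ∉ C := fun h => hiU (mem_union_right _ h)
  have hU' : insert i (B ∪ C) = univ := by rw [hU, insert_erase (mem_univ i)]
  have hsum : ∀ T : Finset α, swapSum ρ T i w ∈ E := fun T =>
    swapSum_mem (subset_univ _) (fun x _ y _ w hw => hEg _ w hw) (mem_univ i) hwE
  have hook : ∀ {B' C' : Finset α} {u : V}, Disjoint B' C' → B' ∪ C' = univ → IsAlt ρ B' u →
      IsSym ρ C' u → u ≠ 0 → u ∈ E → _ := fun h1 h2 h3 h4 h5 h6 =>
    eigenvalue_of_hook h1 h2 h3 h4 h5 (by omega) hθ ((hE _).1 h6)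
  rw [← or_assoc]
  by_cases hX : w - swapSum ρ B i w = 0
  · by_cases hY : w + swapSum ρ C i w = 0
    · right
      exact eigenvalue_of_twist hiB hiC hBC hU' hA hS (sub_eq_zero.1 hX).symm
        (eq_neg_of_add_eq_zero_right hY) hw hn ((hE w).1 hwE)
    · left
      exact hook (by simp [hiB, hBC]) (by rw [union_insert, hU'])
        (hA.add (hA.swapSum_of_disjoint hiB hBC)) (hS.add_swapSum hiC) hY
        (E.add_mem hwE (hsum C))
  · left
    exact hook (by simp [hiC, hBC]) (by rw [insert_union, hU']) (hA.sub_swapSum hiB)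
      (hS.sub (hS.swapSum_of_disjoint hiC hBC)) hX (E.sub_mem hwE (hsum B))

end NearFullSum

end Operators

variable {V : Type*} [AddCommGroup V] [Module ℝ V]

/-! ### The extremal products of weights -/

theorem twistWeight_succ_mul_le {p q : ℕ} (h : p ≤ q) :
    twistWeight (p + 1) * twistWeight q ≤ twistWeight p * twistWeight (q + 1) := by
  simp only [twistWeight, Nat.factorial_succ]
  obtain ⟨d, rfl⟩ := Nat.exists_eq_add_of_le h
  have key : (p + 1) * (p + 1 + 2) * (p + d + 2) ≤ (p + 2) * ((p + d + 1) * (p + d + 1 + 2)) := by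
    ring_nf
    nlinarith [Nat.zero_le (p * d), Nat.zero_le (p ^ 2 * d), Nat.zero_le (p * d ^ 2),
      Nat.zero_le (d ^ 2), Nat.zero_le d]
  calc _ = p.factorial * (p + d).factorial * ((p + 1) * (p + 1 + 2) * (p + d + 2)) := by ring
    _ ≤ p.factorial * (p + d).factorial * ((p + 2) * ((p + d + 1) * (p + d + 1 + 2))) :=
      Nat.mul_le_mul_left _ key
    _ = _ := by ring

theorem twistWeight_add_mul_le (d : ℕ) {r q : ℕ} (h : r ≤ q) :
    twistWeight (r + d) * twistWeight q ≤ twistWeight r * twistWeight (q + d) := by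
  induction d generalizing r with
  | zero => rfl
  | succ d ih =>
    rcases h.eq_or_lt with rfl | h
    · rw [mul_comm]
    · rw [show r + (d + 1) = r + 1 + d by ring]
      exact (ih h).trans (twistWeight_succ_mul_le (by omega))

theorem twistWeight_mul_le {p q r : ℕ} (hp : r ≤ p) (hq : r ≤ q) :
    twistWeight p * twistWeight q ≤ twistWeight r * twistWeight (p + q - r) := by
  obtain ⟨d, rfl⟩ := Nat.exists_eq_add_of_le hp
  rw [show r + d + q - r = q + d by omega]
  exact twistWeight_add_mul_le d hq

/-! ### The regular representation on functions -/

/-- The action of `Perm α` on functions on `Perm α` by left translation. -/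
def regRep (α : Type*) : Perm α →* Module.End ℝ (Perm α → ℝ) where
  toFun h := LinearMap.funLeft ℝ ℝ (fun g => h⁻¹ * g)
  map_one' := by
    ext φ g
    simp
  map_mul' a b := by
    ext φ g
    simp [mul_assoc]

omit [DecidableEq α] in
theorem regRep_apply (h : Perm α) (φ : Perm α → ℝ) (g : Perm α) :
    regRep α h φ g = φ (h⁻¹ * g) := rfl

omit [DecidableEq α] in
theorem regRep_mul (h : Perm α) (φ ψ : Perm α → ℝ) :
    regRep α h (φ * ψ) = regRep α h φ * regRep α h ψ := rfl

theorem dotProduct_regRep [Fintype α] (h : Perm α) (φ ψ : Perm α → ℝ) :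
    φ ⬝ᵥ regRep α h ψ = regRep α h⁻¹ φ ⬝ᵥ ψ := by
  refine Fintype.sum_equiv (Equiv.mulLeft h⁻¹) _ _ fun g => ?_
  simp [regRep_apply]

theorem dotProduct_fullSum [Fintype α] (S : Finset α) (φ ψ : Perm α → ℝ) :
    φ ⬝ᵥ fullSum (regRep α) S ψ = fullSum (regRep α) S φ ⬝ᵥ ψ := by
  rw [fullSum_apply, fullSum_apply, dotProduct_sum, sum_dotProduct]
  refine sum_bij' (fun σ _ => σ⁻¹) (fun σ _ => σ⁻¹) ?_ ?_ ?_ ?_ ?_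
  · intro σ hσ
    simpa using (mem_filter.1 hσ).2.inv
  · intro σ hσ
    simpa using (mem_filter.1 hσ).2.inv
  · simp
  · simp
  · intro σ _
    exact dotProduct_regRep σ φ ψ

theorem fullSum_regRep_eq_zero [Fintype α] (S : Finset α) (φ : Perm α → ℝ)
    (h : fullSum (regRep α) S (fullSum (regRep α) S φ) = 0) : fullSum (regRep α) S φ = 0 := by
  rw [← dotProduct_self_eq_zero, ← dotProduct_fullSum, h, dotProduct_zero]

/-- The function `g ↦ f (g⁻¹ j)`. -/
def coord (f : α → ℝ) (j : α) : Perm α → ℝ := fun g => f (g⁻¹ j)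

omit [DecidableEq α] in
theorem regRep_coord (f : α → ℝ) (h : Perm α) (j : α) :
    regRep α h (coord f j) = coord f (h j) := by
  ext g
  simp [regRep_apply, coord]

/-- The sum over `c ∈ C` of `coord f i - coord f c`. -/
def spread (f : α → ℝ) (C : Finset α) (i : α) : Perm α → ℝ :=
  ∑ c ∈ C, (coord f i - coord f c)

omit [DecidableEq α] in
theorem regRep_spread_of_iff (f : α → ℝ) {C : Finset α} {h : Perm α}
    (hC : ∀ x, h x ∈ C ↔ x ∈ C) (i : α) :
    regRep α h (spread f C i) = spread f C (h i) := by
  simp only [spread, map_sum, map_sub, regRep_coord]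
  exact sum_bij (fun x _ => h x) (fun x hx => (hC x).2 hx) (fun x _ y _ e => h.injective e)
    (fun y hy => ⟨h⁻¹ y, by rw [← hC]; simpa using hy, by simp⟩) (fun x _ => rfl)

omit [DecidableEq α] in
theorem spread_eq (f : α → ℝ) (C : Finset α) (i : α) :
    spread f C i = (#C : ℝ) • coord f i - ∑ c ∈ C, coord f c := by
  rw [spread, sum_sub_distrib, sum_const, Nat.cast_smul_eq_nsmul]

theorem regRep_swap_spread (f : α → ℝ) {C : Finset α} {c x : α} (hc : c ∈ C) (hx : x ∉ C)
    (i : α) : regRep α (swap x c) (spread f C i) =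
      (#C : ℝ) • coord f (swap x c i) - (∑ c ∈ C, coord f c - coord f c + coord f x) := by
  rw [spread_eq, map_sub, map_smul, regRep_coord, map_sum, ← add_sum_erase _ _ hc,
    ← add_sum_erase C (fun c => coord f c) hc, regRep_coord, swap_apply_right]
  rw [sum_congr rfl (g := fun d => coord f d) (fun d hd => ?_)]
  · abel
  · rw [mem_erase] at hd
    rw [regRep_coord, swap_apply_of_ne_of_ne (ne_of_mem_of_not_mem hd.2 hx) hd.1]

section Twist

variable {f : α → ℝ} {B C : Finset α} {i : α} {φ : Perm α → ℝ}

theorem isAlt_mul_spread (hiB : i ∉ B) (hBC : Disjoint B C) (hφ : IsAlt (regRep α) B φ) :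
    IsAlt (regRep α) B (φ * spread f C i) := by
  intro x hx y hy hxy
  rw [regRep_mul, hφ x hx y hy hxy, regRep_spread_of_iff, swap_apply_of_ne_of_ne
    (ne_of_mem_of_not_mem hx hiB).symm (ne_of_mem_of_not_mem hy hiB).symm, neg_mul]
  exact swap_mem_iff_of_notMem (disjoint_left.1 hBC hx) (disjoint_left.1 hBC hy)

theorem isSym_mul_spread (hiC : i ∉ C) (hφ : IsSym (regRep α) (insert i C) φ) :
    IsSym (regRep α) C (φ * spread f C i) := by
  intro x hx y hy
  rw [regRep_mul, hφ x (mem_insert_of_mem hx) y (mem_insert_of_mem hy),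
    regRep_spread_of_iff _ (swap_mem_iff_of_mem hx hy), swap_apply_of_ne_of_ne
    (ne_of_mem_of_not_mem hx hiC).symm (ne_of_mem_of_not_mem hy hiC).symm]

theorem swapSum_mul_spread (hiC : i ∉ C) (hφ : IsSym (regRep α) (insert i C) φ) :
    swapSum (regRep α) C i (φ * spread f C i) = -(φ * spread f C i) := by
  have key : ∀ c ∈ C, regRep α (swap i c) (φ * spread f C i) = φ * ((#C : ℝ) • coord f c -
      (∑ c ∈ C, coord f c - coord f c + coord f i)) := by
    intro c hc
    rw [regRep_mul, hφ i (mem_insert_self _ _) c (mem_insert_of_mem hc),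
      regRep_swap_spread f hc hiC, swap_apply_left]
  rw [swapSum_apply, sum_congr rfl key, ← mul_sum, ← mul_neg]
  congr 1
  simp only [sum_sub_distrib, sum_add_distrib, sum_const, ← smul_sum, spread_eq,
    ← Nat.cast_smul_eq_nsmul ℝ]
  module


theorem nearFullSum_of_crossSum_eq [Fintype α] {ρ : Perm α →* Module.End ℝ V} {v : V}
    (hiB : i ∉ B) (hiC : i ∉ C)
    (hBC : Disjoint B C) (hU : insert i (B ∪ C) = univ) (hA : IsAlt ρ B v) (hS : IsSym ρ C v)
    (hX : swapSum ρ B i v = v) (hY : swapSum ρ C i v = -v)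
    (hZ : ∀ c ∈ C, swapSum ρ B c v = v) {k l : ℕ} (hk : #B = k + 2) (hl : #C = l + 2) :
    nearFullSum ρ v = ((-1) ^ (k + 1) * twistWeight k * twistWeight (l + 1) : ℝ) • v := by
  have hZ' : crossSum ρ B C v = (#C : ℝ) • v := by
    rw [crossSum_apply, sum_congr rfl hZ, sum_const, Nat.cast_smul_eq_nsmul]
  rw [nearFullSum_of_twist hiB hiC hBC hU hA hS hX hY hk hl, hZ', hl]
  simp only [twistWeight, Nat.factorial_succ, pow_succ]
  push_cast
  module

section Pair

variable {a b : α}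

theorem isAlt_pair (f : α → ℝ) : IsAlt (regRep α) {a, b} (coord f a - coord f b) := by
  intro x hx y hy hxy
  rw [mem_insert, mem_singleton] at hx hy
  rw [map_sub, regRep_coord, regRep_coord]
  rcases hx with rfl | rfl <;> rcases hy with rfl | rfl <;> simp_all

theorem isSym_pair (f : α → ℝ) {S : Finset α} (hS : Disjoint {a, b} S) :
    IsSym (regRep α) S (coord f a - coord f b) := by
  intro x hx y hy
  have ha : a ∉ S := disjoint_left.1 hS (by simp)
  have hb : b ∉ S := disjoint_left.1 hS (by simp)
  rw [map_sub, regRep_coord, regRep_coord,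
    swap_apply_of_ne_of_ne (ne_of_mem_of_not_mem hx ha).symm (ne_of_mem_of_not_mem hy ha).symm,
    swap_apply_of_ne_of_ne (ne_of_mem_of_not_mem hx hb).symm (ne_of_mem_of_not_mem hy hb).symm]

theorem swapSum_pair_extra (f : α → ℝ) (hab : a ≠ b) (hiB : i ∉ ({a, b} : Finset α))
    (hiC : i ∉ C) (hBC : Disjoint {a, b} C) :
    swapSum (regRep α) {a, b} i ((coord f a - coord f b) * spread f C i) =
      (coord f a - coord f b) * spread f C i := by
  simp only [mem_insert, mem_singleton, not_or] at hiB
  have ha : a ∉ C := disjoint_left.1 hBC (by simp)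
  have hb : b ∉ C := disjoint_left.1 hBC (by simp)
  rw [swapSum_apply, sum_pair hab]
  simp only [regRep_mul, map_sub, regRep_coord, swap_apply_left, swap_apply_right,
    regRep_spread_of_iff f (swap_mem_iff_of_notMem hiC ha),
    regRep_spread_of_iff f (swap_mem_iff_of_notMem hiC hb),
    swap_apply_of_ne_of_ne (Ne.symm hiB.1) hab, swap_apply_of_ne_of_ne (Ne.symm hiB.2) hab.symm]
  simp only [spread_eq, Algebra.smul_def]
  ring

theorem swapSum_pair_of_mem (f : α → ℝ) (hab : a ≠ b) (hiB : i ∉ ({a, b} : Finset α))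
    (hiC : i ∉ C) (hBC : Disjoint {a, b} C) {c : α} (hc : c ∈ C) :
    swapSum (regRep α) {a, b} c ((coord f a - coord f b) * spread f C i) =
      (coord f a - coord f b) * spread f C i := by
  simp only [mem_insert, mem_singleton, not_or] at hiB
  have ha : a ∉ C := disjoint_left.1 hBC (by simp)
  have hb : b ∉ C := disjoint_left.1 hBC (by simp)
  have hca := ne_of_mem_of_not_mem hc ha
  have hcb := ne_of_mem_of_not_mem hc hb
  have hci := ne_of_mem_of_not_mem hc hiC
  rw [swapSum_apply, sum_pair hab, swap_comm c a, swap_comm c b]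
  simp only [regRep_mul, map_sub, regRep_coord, swap_apply_left,
    regRep_swap_spread f hc ha, regRep_swap_spread f hc hb,
    swap_apply_of_ne_of_ne hab hca.symm, swap_apply_of_ne_of_ne hab.symm hcb.symm,
    swap_apply_of_ne_of_ne hiB.1 hci.symm, swap_apply_of_ne_of_ne hiB.2 hci.symm]
  simp only [spread_eq, Algebra.smul_def]
  ring

theorem nearFullSum_pair [Fintype α] (f : α → ℝ) (hab : a ≠ b) (hiB : i ∉ ({a, b} : Finset α))
    (hiC : i ∉ C) (hBC : Disjoint {a, b} C) (hU : insert i ({a, b} ∪ C) = univ) {l : ℕ}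
    (hl : #C = l + 2) :
    nearFullSum (regRep α) ((coord f a - coord f b) * spread f C i) =
      (-(twistWeight 0 * twistWeight (l + 1)) : ℝ) •
        ((coord f a - coord f b) * spread f C i) := by
  have hsym : IsSym (regRep α) (insert i C) (coord f a - coord f b) :=
    isSym_pair f (disjoint_insert_right.2 ⟨hiB, hBC⟩)
  rw [nearFullSum_of_crossSum_eq hiB hiC hBC hU (isAlt_mul_spread hiB hBC (isAlt_pair f))
    (isSym_mul_spread hiC hsym) (swapSum_pair_extra f hab hiB hiC hBC)
    (swapSum_mul_spread hiC hsym) (fun c hc => swapSum_pair_of_mem f hab hiB hiC hBC hc)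
    (k := 0) (card_pair hab) hl]
  simp

end Pair

section Triple

variable {a b d : α}

theorem isAlt_triple (f : α → ℝ) (hab : a ≠ b) (had : a ≠ d) (hbd : b ≠ d) :
    IsAlt (regRep α) {a, b, d}
      ((coord f a - coord f b) * (coord f a - coord f d) * (coord f b - coord f d)) := by
  intro x hx y hy hxy
  simp only [mem_insert, mem_singleton] at hx hy
  rw [regRep_mul, regRep_mul, map_sub, map_sub, map_sub, regRep_coord, regRep_coord, regRep_coord]
  rcases hx with rfl | rfl | rfl <;> rcases hy with rfl | rfl | rfl <;>
    first
    | exact absurd rfl hxy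
    | simp only [swap_apply_left, swap_apply_right, swap_apply_of_ne_of_ne had hab,
        swap_apply_of_ne_of_ne hab had, swap_apply_of_ne_of_ne hab.symm hbd,
        swap_apply_of_ne_of_ne hbd hab.symm, swap_apply_of_ne_of_ne had.symm hbd.symm,
        swap_apply_of_ne_of_ne hbd.symm had.symm]
      ring

theorem isSym_triple (f : α → ℝ) {S : Finset α} (hS : Disjoint {a, b, d} S) :
    IsSym (regRep α) S
      ((coord f a - coord f b) * (coord f a - coord f d) * (coord f b - coord f d)) := by
  intro x hx y hy
  rw [regRep_mul, regRep_mul, isSym_pair f (hS.mono_left (by grind)) x hx y hy,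
    isSym_pair f (hS.mono_left (by grind)) x hx y hy,
    isSym_pair f (hS.mono_left (by grind)) x hx y hy]

theorem sum_triple {M : Type*} [AddCommMonoid M] (hab : a ≠ b) (had : a ≠ d) (hbd : b ≠ d)
    (F : α → M) : ∑ x ∈ ({a, b, d} : Finset α), F x = F a + (F b + F d) := by
  rw [sum_insert (by simp [hab, had]), sum_pair hbd]

theorem swapSum_triple_extra (f : α → ℝ) (hab : a ≠ b) (had : a ≠ d) (hbd : b ≠ d)
    (hiB : i ∉ ({a, b, d} : Finset α)) (hiC : i ∉ C) (hBC : Disjoint {a, b, d} C) :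
    swapSum (regRep α) {a, b, d} i
        ((coord f a - coord f b) * (coord f a - coord f d) * (coord f b - coord f d) *
          spread f C i) =
      (coord f a - coord f b) * (coord f a - coord f d) * (coord f b - coord f d) *
        spread f C i := by
  simp only [mem_insert, mem_singleton, not_or] at hiB
  have ha : a ∉ C := disjoint_left.1 hBC (by simp)
  have hb : b ∉ C := disjoint_left.1 hBC (by simp)
  have hd : d ∉ C := disjoint_left.1 hBC (by simp)
  rw [swapSum_apply, sum_triple hab had hbd]
  simp only [regRep_mul, map_sub, regRep_coord, swap_apply_left, swap_apply_right,
    regRep_spread_of_iff f (swap_mem_iff_of_notMem hiC ha),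
    regRep_spread_of_iff f (swap_mem_iff_of_notMem hiC hb),
    regRep_spread_of_iff f (swap_mem_iff_of_notMem hiC hd),
    swap_apply_of_ne_of_ne (Ne.symm hiB.1) hab, swap_apply_of_ne_of_ne (Ne.symm hiB.1) had,
    swap_apply_of_ne_of_ne (Ne.symm hiB.2.1) hab.symm, swap_apply_of_ne_of_ne (Ne.symm hiB.2.1) hbd,
    swap_apply_of_ne_of_ne (Ne.symm hiB.2.2) had.symm,
    swap_apply_of_ne_of_ne (Ne.symm hiB.2.2) hbd.symm]
  simp only [spread_eq, Algebra.smul_def]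
  ring

theorem swapSum_triple_of_mem (f : α → ℝ) (hab : a ≠ b) (had : a ≠ d) (hbd : b ≠ d)
    (hiB : i ∉ ({a, b, d} : Finset α)) (hiC : i ∉ C) (hBC : Disjoint {a, b, d} C) {c : α}
    (hc : c ∈ C) :
    swapSum (regRep α) {a, b, d} c
        ((coord f a - coord f b) * (coord f a - coord f d) * (coord f b - coord f d) *
          spread f C i) =
      (coord f a - coord f b) * (coord f a - coord f d) * (coord f b - coord f d) *
        spread f C i := by
  simp only [mem_insert, mem_singleton, not_or] at hiB
  have ha : a ∉ C := disjoint_left.1 hBC (by simp)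
  have hb : b ∉ C := disjoint_left.1 hBC (by simp)
  have hd : d ∉ C := disjoint_left.1 hBC (by simp)
  have hca := (ne_of_mem_of_not_mem hc ha).symm
  have hcb := (ne_of_mem_of_not_mem hc hb).symm
  have hcd := (ne_of_mem_of_not_mem hc hd).symm
  have hci := (ne_of_mem_of_not_mem hc hiC).symm
  rw [swapSum_apply, sum_triple hab had hbd, swap_comm c a, swap_comm c b, swap_comm c d]
  simp only [regRep_mul, map_sub, regRep_coord, swap_apply_left,
    regRep_swap_spread f hc ha, regRep_swap_spread f hc hb, regRep_swap_spread f hc hd,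
    swap_apply_of_ne_of_ne hab.symm hcb, swap_apply_of_ne_of_ne had.symm hcd,
    swap_apply_of_ne_of_ne hab hca, swap_apply_of_ne_of_ne hbd.symm hcd,
    swap_apply_of_ne_of_ne had hca, swap_apply_of_ne_of_ne hbd hcb,
    swap_apply_of_ne_of_ne hiB.1 hci, swap_apply_of_ne_of_ne hiB.2.1 hci,
    swap_apply_of_ne_of_ne hiB.2.2 hci]
  simp only [spread_eq, Algebra.smul_def]
  ring

theorem nearFullSum_triple [Fintype α] (f : α → ℝ) (hab : a ≠ b) (had : a ≠ d) (hbd : b ≠ d)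
    (hiB : i ∉ ({a, b, d} : Finset α)) (hiC : i ∉ C) (hBC : Disjoint {a, b, d} C)
    (hU : insert i ({a, b, d} ∪ C) = univ) {l : ℕ} (hl : #C = l + 2) :
    nearFullSum (regRep α)
        ((coord f a - coord f b) * (coord f a - coord f d) * (coord f b - coord f d) *
          spread f C i) =
      (twistWeight 1 * twistWeight (l + 1) : ℝ) •
        ((coord f a - coord f b) * (coord f a - coord f d) * (coord f b - coord f d) *
          spread f C i) := by
  have hsym := isSym_triple f (S := insert i C) (disjoint_insert_right.2 ⟨hiB, hBC⟩)
  rw [nearFullSum_of_crossSum_eq hiB hiC hBC hU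
    (isAlt_mul_spread hiB hBC (isAlt_triple f hab had hbd))
    (isSym_mul_spread hiC hsym) (swapSum_triple_extra f hab had hbd hiB hiC hBC)
    (swapSum_mul_spread hiC hsym)
    (fun c hc => swapSum_triple_of_mem f hab had hbd hiB hiC hBC hc)
    (k := 1) (card_eq_three.2 ⟨a, b, d, hab, had, hbd, rfl⟩) hl]
  norm_num

end Triple

end Twist

/-! ### Existence of the extremal eigenvalues -/

section Fin

variable {n : ℕ}

theorem card_of_insert_union [Fintype α] {B C : Finset α} {i : α} (hiB : i ∉ B) (hiC : i ∉ C)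
    (hBC : Disjoint B C) (hU : insert i (B ∪ C) = univ) : Fintype.card α = #B + #C + 1 := by
  rw [← card_univ, ← hU, card_insert_of_notMem (by simp [hiB, hiC]), card_union_of_disjoint hBC]

theorem exists_nearFullSum_pair (hn : 5 ≤ n) : ∃ φ : Perm (Fin n) → ℝ, φ ≠ 0 ∧
    nearFullSum (regRep (Fin n)) φ = (-(2 * (n - 2) * (n - 4).factorial : ℕ) : ℝ) • φ := by
  obtain ⟨l, rfl⟩ := Nat.exists_eq_add_of_le' hn
  let f : Fin (l + 5) → ℝ := fun x => (x : ℕ)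
  have hf : ∀ x y : Fin (l + 5), x < y → f x < f y := fun x y h => Nat.cast_lt.2 h
  let a : Fin (l + 5) := ⟨0, by omega⟩
  let b : Fin (l + 5) := ⟨1, by omega⟩
  let i : Fin (l + 5) := Fin.last _
  let C : Finset (Fin (l + 5)) := univ \ {i, a, b}
  have hab : a < b := by simp [a, b]
  have hbi : b < i := by simp [i, b, Fin.lt_def]
  have hai : a < i := hab.trans hbi
  have hiB : i ∉ ({a, b} : Finset _) := by simp [hai.ne', hbi.ne']
  have hiC : i ∉ C := by simp [C]
  have hBC : Disjoint {a, b} C := by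
    rw [disjoint_left]
    intro x hx
    simp only [C, mem_sdiff, mem_univ, true_and, not_not]
    exact mem_insert_of_mem hx
  have hU : insert i ({a, b} ∪ C) = univ := by
    ext x
    simp only [C, mem_insert, mem_union, mem_sdiff, mem_univ, mem_singleton]
    tauto
  have hC : #C = l + 2 := by
    have := card_of_insert_union hiB hiC hBC hU
    rw [Fintype.card_fin, card_pair hab.ne] at this
    omega
  refine ⟨(coord f a - coord f b) * spread f C i, ?_, ?_⟩
  · intro h0
    have h1 := congrFun h0 1
    have hpos : 0 < ∑ c ∈ C, (f i - f c) := by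
      refine sum_pos (fun c hc => sub_pos.2 (hf _ _ (lt_of_le_of_ne (Fin.le_last c)
        (ne_of_mem_of_not_mem hc hiC)))) (card_pos.1 (by omega))
    have hneg := sub_neg.2 (hf _ _ hab)
    refine (mul_neg_of_neg_of_pos hneg hpos).ne ?_
    simpa [spread, coord] using h1
  · rw [nearFullSum_pair f hab.ne hiB hiC hBC hU hC]
    congr 1
    rw [show l + 5 - 2 = l + 1 + 2 by omega, show l + 5 - 4 = l + 1 by omega]
    simp only [twistWeight, Nat.factorial_zero]
    push_cast
    ring

theorem exists_nearFullSum_triple (hn : 6 ≤ n) : ∃ φ : Perm (Fin n) → ℝ, φ ≠ 0 ∧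
    nearFullSum (regRep (Fin n)) φ = ((3 * (n - 3) * (n - 5).factorial : ℕ) : ℝ) • φ := by
  obtain ⟨l, rfl⟩ := Nat.exists_eq_add_of_le' hn
  let f : Fin (l + 6) → ℝ := fun x => (x : ℕ)
  have hf : ∀ x y : Fin (l + 6), x < y → f x < f y := fun x y h => Nat.cast_lt.2 h
  let a : Fin (l + 6) := ⟨0, by omega⟩
  let b : Fin (l + 6) := ⟨1, by omega⟩
  let d : Fin (l + 6) := ⟨2, by omega⟩
  let i : Fin (l + 6) := Fin.last _
  let C : Finset (Fin (l + 6)) := univ \ {i, a, b, d}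
  have hab : a < b := by simp [a, b]
  have hbd : b < d := by simp [d, b, Fin.lt_def]
  have hdi : d < i := by simp [i, d, Fin.lt_def]
  have had := hab.trans hbd
  have hbi := hbd.trans hdi
  have hai := hab.trans hbi
  have hiB : i ∉ ({a, b, d} : Finset _) := by simp [hai.ne', hbi.ne', hdi.ne']
  have hiC : i ∉ C := by simp [C]
  have hBC : Disjoint {a, b, d} C := by
    rw [disjoint_left]
    intro x hx
    simp only [C, mem_sdiff, mem_univ, true_and, not_not]
    exact mem_insert_of_mem hx
  have hU : insert i ({a, b, d} ∪ C) = univ := by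
    ext x
    simp only [C, mem_insert, mem_union, mem_sdiff, mem_univ, mem_singleton]
    tauto
  have hC : #C = l + 2 := by
    have := card_of_insert_union hiB hiC hBC hU
    rw [Fintype.card_fin, card_eq_three.2 ⟨a, b, d, hab.ne, had.ne, hbd.ne, rfl⟩] at this
    omega
  refine ⟨(coord f a - coord f b) * (coord f a - coord f d) * (coord f b - coord f d) *
    spread f C i, ?_, ?_⟩
  · intro h0
    have h1 := congrFun h0 1
    have hpos : 0 < ∑ c ∈ C, (f i - f c) := by
      refine sum_pos (fun c hc => sub_pos.2 (hf _ _ (lt_of_le_of_ne (Fin.le_last c)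
        (ne_of_mem_of_not_mem hc hiC)))) (card_pos.1 (by omega))
    have h2 := sub_neg.2 (hf _ _ hab)
    have h3 := sub_neg.2 (hf _ _ had)
    have h4 := sub_neg.2 (hf _ _ hbd)
    refine (mul_neg_of_neg_of_pos (mul_neg_of_pos_of_neg (mul_pos_of_neg_of_neg h2 h3) h4)
      hpos).ne ?_
    simpa [spread, coord] using h1
  · rw [nearFullSum_triple f hab.ne had.ne hbd.ne hiB hiC hBC hU hC]
    congr 1
    rw [show l + 6 - 3 = l + 1 + 2 by omega, show l + 6 - 5 = l + 1 by omega]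
    simp only [twistWeight, Nat.factorial_one]
    push_cast
    ring

end Fin

theorem IsFullCycle.sign [Fintype α] {S : Finset α} (hS : 2 ≤ #S) {σ : Perm α}
    (h : IsFullCycle S σ) : Perm.sign σ = -(-1) ^ #S := by
  obtain ⟨hc, hs⟩ := (isFullCycle_iff_isCycle hS σ).1 h
  rw [hc.sign, hs]

/-- Multiplying by the sign character negates the operator when `n` is odd. -/
theorem nearFullSum_sign_mul [Fintype α] (hn : 3 ≤ Fintype.card α) (hodd : Odd (Fintype.card α))
    (φ : Perm α → ℝ) :
    nearFullSum (regRep α) (fun g => ((Perm.sign g : ℤ) : ℝ) * φ g) =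
      fun g => -((Perm.sign g : ℤ) : ℝ) * nearFullSum (regRep α) φ g := by
  ext g
  simp only [nearFullSum_apply, fullSum_apply, Finset.sum_apply, mul_sum]
  refine sum_congr rfl fun j _ => sum_congr rfl fun σ hσ => ?_
  have hcard : #(univ.erase j) = Fintype.card α - 1 := card_erase_of_mem (mem_univ j)
  have hs := (mem_filter.1 hσ).2.sign (by omega)
  have hev : Even (Fintype.card α - 1) := hodd.tsub_odd odd_one
  rw [hcard, hev.neg_one_pow] at hs
  simp [regRep_apply, hs]

theorem exists_nearFullSum_of_odd {n : ℕ} (hn : 5 ≤ n) (hodd : Odd n) :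
    ∃ φ : Perm (Fin n) → ℝ, φ ≠ 0 ∧
      nearFullSum (regRep (Fin n)) φ = ((2 * (n - 2) * (n - 4).factorial : ℕ) : ℝ) • φ := by
  obtain ⟨φ, hφ, h⟩ := exists_nearFullSum_pair hn
  refine ⟨fun g => ((Perm.sign g : ℤ) : ℝ) * φ g, fun h0 => hφ ?_, ?_⟩
  · ext g
    have := congrFun h0 g
    simpa using this
  · rw [nearFullSum_sign_mul (by rw [Fintype.card_fin]; omega) (by rwa [Fintype.card_fin]), h]
    ext g
    simp only [Pi.smul_apply, smul_eq_mul]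
    ring

theorem nearFullSum_one [Fintype α] (hn : 2 ≤ Fintype.card α) :
    nearFullSum (regRep α) 1 =
      (Fintype.card α * (Fintype.card α - 2).factorial : ℝ) • (1 : Perm α → ℝ) :=
  nearFullSum_of_isSym (fun _ _ _ _ => rfl) hn

/-! ### Translation to Cayley graphs -/

theorem nearFullSum_regRep_apply {n : ℕ} (hn : 3 ≤ n) (φ : Perm (Fin n) → ℝ)
    (g : Perm (Fin n)) [DecidablePred (· ∈ nm1Cycles n)] :
    nearFullSum (regRep (Fin n)) φ g = ∑ σ with σ ∈ nm1Cycles n, φ (σ⁻¹ * g) := by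
  have hcard : ∀ j : Fin n, #(univ.erase j) = n - 1 := fun j => by
    rw [card_erase_of_mem (mem_univ j), card_univ, Fintype.card_fin]
  simp only [nearFullSum_apply, fullSum_apply, Finset.sum_apply, regRep_apply]
  simp only [sum_filter]
  rw [sum_comm]
  refine sum_congr rfl fun σ _ => ?_
  have hiff : ∀ j, IsFullCycle (univ.erase j) σ ↔ σ.IsCycle ∧ σ.support = univ.erase j :=
    fun j => isFullCycle_iff_isCycle (by rw [hcard]; omega) σ
  by_cases hσ : σ ∈ nm1Cycles n
  · have hc : #(σ.support)ᶜ = 1 := by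
      rw [card_compl, Fintype.card_fin, hσ.2]
      omega
    obtain ⟨j, hj⟩ := card_eq_one.1 hc
    have hj' : σ.support = univ.erase j := by
      rw [← compl_compl σ.support, hj, compl_singleton]
    rw [if_pos hσ, sum_eq_single j]
    · rw [if_pos ((hiff j).2 ⟨hσ.1, hj'⟩)]
    · intro k _ hk
      rw [if_neg]
      intro h
      have := ((hiff k).1 h).2
      rw [hj'] at this
      have hk' : k ∈ univ.erase j := mem_erase.2 ⟨hk, mem_univ k⟩
      rw [this] at hk'
      exact notMem_erase _ _ hk'
    · exact fun h => absurd (mem_univ j) h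
  · rw [if_neg hσ]
    refine sum_eq_zero fun j _ => if_neg fun h => hσ ?_
    have := (hiff j).1 h
    exact ⟨this.1, by rw [this.2, hcard]⟩

open Classical in
theorem mem_graphEigs_iff {W : Type*} [Fintype W] (Γ : SimpleGraph W) (μ : ℝ) :
    μ ∈ graphEigs Γ ↔ ∃ φ : W → ℝ, φ ≠ 0 ∧ ∀ u, ∑ v with Γ.Adj u v, φ v = μ * φ u := by
  have hinst : Fintype.ofFinite W = ‹Fintype W› := Subsingleton.elim _ _
  have h1 : graphEigs Γ = spectrum ℝ (Γ.adjMatrix ℝ) := by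
    unfold graphEigs
    rw [hinst]
  rw [h1, ← Matrix.spectrum_toLin', ← Module.End.hasEigenvalue_iff_mem_spectrum]
  constructor
  · intro h
    obtain ⟨φ, hφ⟩ := h.exists_hasEigenvector
    refine ⟨φ, hφ.2, fun u => ?_⟩
    have := congrFun hφ.apply_eq_smul u
    rw [Matrix.toLin'_apply, SimpleGraph.adjMatrix_mulVec_apply] at this
    simpa [SimpleGraph.neighborFinset_eq_filter] using this
  · rintro ⟨φ, hφ, h⟩
    refine Module.End.hasEigenvalue_of_hasEigenvector (x := φ) ⟨?_, hφ⟩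
    rw [Module.End.mem_eigenspace_iff]
    ext u
    rw [Matrix.toLin'_apply, SimpleGraph.adjMatrix_mulVec_apply]
    simpa [SimpleGraph.neighborFinset_eq_filter] using h u

open Classical in
theorem mem_graphEigs_cayleyGraph_iff {G : Type*} [Group G] [Fintype G] {H : Set G} (h1 : 1 ∉ H)
    (hinv : ∀ h ∈ H, h⁻¹ ∈ H) (μ : ℝ) :
    μ ∈ graphEigs (cayleyGraph H) ↔
      ∃ φ : G → ℝ, φ ≠ 0 ∧ ∀ u, ∑ h with h ∈ H, φ (h⁻¹ * u) = μ * φ u := by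
  rw [mem_graphEigs_iff]
  refine exists_congr fun φ => and_congr_right fun _ => forall_congr' fun u => ?_
  have hadj : ∀ v, (cayleyGraph H).Adj u v ↔ u * v⁻¹ ∈ H := by
    intro v
    rw [cayleyGraph, SimpleGraph.fromRel_adj]
    constructor
    · rintro ⟨_, h | h⟩
      · exact h
      · simpa using hinv _ h
    · refine fun h => ⟨?_, Or.inl h⟩
      rintro rfl
      exact h1 (by simpa using h)
  have : ∑ v with (cayleyGraph H).Adj u v, φ v = ∑ h with h ∈ H, φ (h⁻¹ * u) := by
    refine sum_bij' (fun v _ => u * v⁻¹) (fun h _ => h⁻¹ * u) ?_ ?_ ?_ ?_ ?_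
    · intro v hv
      simpa [hadj] using hv
    · intro h hh
      simpa [hadj] using hh
    · simp
    · simp
    · simp
  rw [this]

theorem one_notMem_nm1Cycles (n : ℕ) : 1 ∉ nm1Cycles n := fun h => Perm.not_isCycle_one h.1

theorem inv_mem_nm1Cycles {n : ℕ} {g : Perm (Fin n)} (h : g ∈ nm1Cycles n) :
    g⁻¹ ∈ nm1Cycles n := ⟨h.1.inv, by rw [Perm.support_inv]; exact h.2⟩

theorem mem_graphEigs_nm1Cycles_iff {n : ℕ} (hn : 3 ≤ n) (μ : ℝ) :
    μ ∈ graphEigs (cayleyGraph (nm1Cycles n)) ↔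
      ∃ φ : Perm (Fin n) → ℝ, φ ≠ 0 ∧ nearFullSum (regRep (Fin n)) φ = μ • φ := by
  classical
  rw [mem_graphEigs_cayleyGraph_iff (one_notMem_nm1Cycles n) (fun _ => inv_mem_nm1Cycles)]
  refine exists_congr fun φ => and_congr_right fun _ => ?_
  rw [funext_iff]
  refine forall_congr' fun u => ?_
  rw [nearFullSum_regRep_apply hn, Pi.smul_apply, smul_eq_mul]

theorem nm1Cycles_subset_alternatingGroup {n : ℕ} (hn : Even n) (h0 : n ≠ 0)
    {σ : Perm (Fin n)} (h : σ ∈ nm1Cycles n) : σ ∈ alternatingGroup (Fin n) := by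
  have hodd : Odd (n - 1) := Nat.Even.sub_odd (by omega) hn odd_one
  rw [Perm.mem_alternatingGroup, h.1.sign, h.2, hodd.neg_one_pow, neg_neg]

open Classical in
theorem sum_nm1CyclesAlt {n : ℕ} (hn : Even n) (h0 : n ≠ 0) (F : Perm (Fin n) → ℝ) :
    ∑ h with h ∈ nm1CyclesAlt n, F h = ∑ σ with σ ∈ nm1Cycles n, F σ := by
  refine sum_bij (fun h _ => (h : Perm (Fin n))) ?_ ?_ ?_ ?_
  · intro h hh
    exact mem_filter.2 ⟨mem_univ _, (mem_filter.1 hh).2⟩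
  · exact fun _ _ _ _ e => Subtype.ext e
  · intro σ hσ
    refine ⟨⟨σ, nm1Cycles_subset_alternatingGroup hn h0 (mem_filter.1 hσ).2⟩, ?_, rfl⟩
    exact mem_filter.2 ⟨mem_univ _, (mem_filter.1 hσ).2⟩
  · exact fun _ _ => rfl

theorem mem_graphEigs_nm1CyclesAlt_iff {n : ℕ} (hn : 3 ≤ n) (hev : Even n) (μ : ℝ) :
    μ ∈ graphEigs (cayleyGraph (nm1CyclesAlt n)) ↔
      ∃ φ : Perm (Fin n) → ℝ, φ ≠ 0 ∧ nearFullSum (regRep (Fin n)) φ = μ • φ := by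
  classical
  have hn0 : n ≠ 0 := by omega
  rw [mem_graphEigs_cayleyGraph_iff (H := nm1CyclesAlt n)
    (fun h => one_notMem_nm1Cycles n h) (fun _ h => inv_mem_nm1Cycles (n := n) h)]
  constructor
  · rintro ⟨ψ, hψ, h⟩
    let φ : Perm (Fin n) → ℝ := fun g =>
      if hg : g ∈ alternatingGroup (Fin n) then ψ ⟨g, hg⟩ else 0
    have hφψ : ∀ a : alternatingGroup (Fin n), φ a = ψ a := fun a => dif_pos a.2
    refine ⟨φ, fun h0 => hψ ?_, ?_⟩
    · ext a
      rw [← hφψ, h0]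
      rfl
    · ext g
      rw [nearFullSum_regRep_apply hn, Pi.smul_apply, smul_eq_mul]
      by_cases hg : g ∈ alternatingGroup (Fin n)
      · have := h ⟨g, hg⟩
        rw [← hφψ, ← sum_congr rfl fun a _ => hφψ _] at this
        rw [← this]
        exact (sum_nm1CyclesAlt hev hn0 fun σ => φ (σ⁻¹ * g)).symm
      · rw [show φ g = 0 from dif_neg hg, mul_zero]
        refine sum_eq_zero fun σ hσ => dif_neg ?_
        have hσ' := nm1Cycles_subset_alternatingGroup hev hn0 (mem_filter.1 hσ).2
        rwa [Subgroup.mul_mem_cancel_left _ (inv_mem hσ')]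
  · rintro ⟨φ, hφ, h⟩
    obtain ⟨g, hg⟩ := Function.ne_iff.1 hφ
    refine ⟨fun a => φ (a * g), fun h0 => hg ?_, fun a => ?_⟩
    · simpa using congrFun h0 1
    · have := congrFun h (a * g)
      rw [nearFullSum_regRep_apply hn, Pi.smul_apply, smul_eq_mul] at this
      rw [← this, ← sum_nm1CyclesAlt hev hn0]
      refine sum_congr rfl fun σ _ => ?_
      simp [mul_assoc]

/-! ### The two largest eigenvalues -/

theorem eigenvalue_eq_or_nonpos_or {n : ℕ} (hn : 4 ≤ n) {μ : ℝ} {φ : Perm (Fin n) → ℝ}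
    (hφ : φ ≠ 0) (h : nearFullSum (regRep (Fin n)) φ = μ • φ) :
    μ = ((n * (n - 2).factorial : ℕ) : ℝ) ∨ μ ≤ 0 ∨
      ∃ p q, Odd p ∧ p + q + 4 = n ∧ μ = ((twistWeight p * twistWeight q : ℕ) : ℝ) := by
  rcases eq_or_ne μ 0 with h0 | h0
  · exact Or.inr (Or.inl h0.le)
  have := eigenvalue_nearFullSum (fun T v => fullSum_regRep_eq_zero T v)
    (by rwa [Fintype.card_fin]) h0 hφ h
  rw [Fintype.card_fin] at this
  push_cast
  rcases this with h1 | h1 | ⟨p, q, hpq, h1⟩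
  · exact Or.inl h1
  · rcases Nat.even_or_odd n with he | ho
    · rw [he.neg_one_pow, one_mul] at h1
      exact Or.inl h1
    · rw [ho.neg_one_pow] at h1
      refine Or.inr (Or.inl ?_)
      rw [h1, neg_one_mul]
      exact neg_nonpos.2 (by positivity)
  · rcases Nat.even_or_odd p with he | ho
    · rw [he.add_one.neg_one_pow, neg_one_mul, neg_mul] at h1
      refine Or.inr (Or.inl ?_)
      rw [h1]
      exact neg_nonpos.2 (by positivity)
    · rw [ho.add_one.neg_one_pow, one_mul] at h1
      exact Or.inr (Or.inr ⟨p, q, ho, hpq, h1⟩)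

theorem eigenvalue_le_of_ne {n : ℕ} (hn : 4 ≤ n) {μ : ℝ} {φ : Perm (Fin n) → ℝ} (hφ : φ ≠ 0)
    (h : nearFullSum (regRep (Fin n)) φ = μ • φ) (hμ : μ ≠ ((n * (n - 2).factorial : ℕ) : ℝ)) :
    μ ≤ ((2 * (n - 2) * (n - 4).factorial : ℕ) : ℝ) := by
  rcases (eigenvalue_eq_or_nonpos_or hn hφ h).resolve_left hμ with h1 | ⟨p, q, -, hpq, rfl⟩
  · exact h1.trans (Nat.cast_nonneg _)
  · have := twistWeight_mul_le (Nat.zero_le p) (Nat.zero_le q)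
    rw [show p + q - 0 = n - 4 by omega] at this
    refine Nat.cast_le.2 (this.trans_eq ?_)
    rw [twistWeight, twistWeight, show n - 4 + 2 = n - 2 by omega, Nat.factorial_zero]
    ring

theorem eigenvalue_le_of_ne_of_even {n : ℕ} (hn : 4 ≤ n) (hev : Even n) {μ : ℝ}
    {φ : Perm (Fin n) → ℝ} (hφ : φ ≠ 0) (h : nearFullSum (regRep (Fin n)) φ = μ • φ)
    (hμ : μ ≠ ((n * (n - 2).factorial : ℕ) : ℝ)) :
    μ ≤ ((3 * (n - 3) * (n - 5).factorial : ℕ) : ℝ) := by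
  rcases (eigenvalue_eq_or_nonpos_or hn hφ h).resolve_left hμ with h1 | ⟨p, q, hp, hpq, rfl⟩
  · exact h1.trans (Nat.cast_nonneg _)
  · have hq : Odd q := by
      grind
    have := twistWeight_mul_le (r := 1) hp.pos hq.pos
    have hp0 := hp.pos
    have hq0 := hq.pos
    rw [show p + q - 1 = n - 5 by omega] at this
    refine Nat.cast_le.2 (this.trans_eq ?_)
    rw [twistWeight, twistWeight, show n - 5 + 2 = n - 3 by omega, Nat.factorial_one]
    ring

theorem two_mul_factorial_lt {n : ℕ} (hn : 4 ≤ n) :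
    2 * (n - 2) * (n - 4).factorial < n * (n - 2).factorial := by
  obtain ⟨m, rfl⟩ := Nat.exists_eq_add_of_le' hn
  rw [show m + 4 - 2 = m + 2 by omega, Nat.add_sub_cancel, Nat.factorial_succ,
    Nat.factorial_succ]
  have := m.factorial_pos
  calc _ = (m + 2) * m.factorial * 2 := by ring
    _ < (m + 2) * m.factorial * ((m + 4) * (m + 1)) := by
      gcongr
      nlinarith
    _ = _ := by ring

theorem three_mul_factorial_lt {n : ℕ} (hn : 5 ≤ n) :
    3 * (n - 3) * (n - 5).factorial < n * (n - 2).factorial := by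
  obtain ⟨m, rfl⟩ := Nat.exists_eq_add_of_le' hn
  rw [show m + 5 - 2 = m + 3 by omega, show m + 5 - 3 = m + 2 by omega, Nat.add_sub_cancel,
    Nat.factorial_succ, Nat.factorial_succ, Nat.factorial_succ]
  have := m.factorial_pos
  calc _ = (m + 2) * m.factorial * 3 := by ring
    _ < (m + 2) * m.factorial * ((m + 5) * (m + 3) * (m + 1)) := by
      gcongr
      nlinarith [Nat.zero_le (m ^ 3), Nat.zero_le (m ^ 2)]
    _ = _ := by ring

theorem isGreatest_of_forall_ne {s : Set ℝ} {a b : ℝ} (ha : a ∈ s) (hb : b ∈ s) (hba : b < a)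
    (h : ∀ x ∈ s, x ≠ a → x ≤ b) : IsGreatest s a ∧ IsGreatest {x | x ∈ s ∧ x < a} b := by
  refine ⟨⟨ha, fun x hx => ?_⟩, ⟨hb, hba⟩, fun x hx => h x hx.1 hx.2.ne⟩
  rcases eq_or_ne x a with rfl | hxa
  · rfl
  · exact (h x hx hxa).trans hba.le

theorem exists_nearFullSum_one {n : ℕ} (hn : 2 ≤ n) : ∃ φ : Perm (Fin n) → ℝ, φ ≠ 0 ∧
    nearFullSum (regRep (Fin n)) φ = ((n * (n - 2).factorial : ℕ) : ℝ) • φ := by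
  refine ⟨1, one_ne_zero, ?_⟩
  rw [nearFullSum_one (by rwa [Fintype.card_fin]), Fintype.card_fin]
  push_cast
  rfl

end FullCycle

/-- Let `n > 4`, `H = C(n,n-1)` the set of all `(n-1)`-cycles, `G = S_n` for `n` odd and
`G = A_n` for `n` even, and `Γ = Cay(G,H)`.  Then `λ₁(Γ) = n·(n-2)!`; moreover
`λ₂(Γ) = 3(n-3)·(n-5)!` for `n` even and `λ₂(Γ) = 2(n-2)·(n-4)!` for `n` odd. -/
theorem stmt1 (n : ℕ) (hn : 4 < n) :
    (Odd n →
      IsGreatest (graphEigs (cayleyGraph (nm1Cycles n))) ((n * (n - 2).factorial : ℕ) : ℝ) ∧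
      IsGreatest
        {μ : ℝ | μ ∈ graphEigs (cayleyGraph (nm1Cycles n)) ∧
          μ < ((n * (n - 2).factorial : ℕ) : ℝ)}
        ((2 * (n - 2) * (n - 4).factorial : ℕ) : ℝ)) ∧
    (Even n →
      IsGreatest (graphEigs (cayleyGraph (nm1CyclesAlt n))) ((n * (n - 2).factorial : ℕ) : ℝ) ∧
      IsGreatest
        {μ : ℝ | μ ∈ graphEigs (cayleyGraph (nm1CyclesAlt n)) ∧
          μ < ((n * (n - 2).factorial : ℕ) : ℝ)}
        ((3 * (n - 3) * (n - 5).factorial : ℕ) : ℝ)) := by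
  constructor
  · intro hodd
    refine FullCycle.isGreatest_of_forall_ne
      ((FullCycle.mem_graphEigs_nm1Cycles_iff (by omega) _).2
        (FullCycle.exists_nearFullSum_one (by omega)))
      ((FullCycle.mem_graphEigs_nm1Cycles_iff (by omega) _).2
        (FullCycle.exists_nearFullSum_of_odd hn hodd))
      (Nat.cast_lt.2 (FullCycle.two_mul_factorial_lt hn.le)) fun μ hμ hne => ?_
    obtain ⟨φ, hφ, h⟩ := (FullCycle.mem_graphEigs_nm1Cycles_iff (by omega) _).1 hμ
    exact FullCycle.eigenvalue_le_of_ne hn.le hφ h hne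
  · intro hev
    have hn6 : 6 ≤ n := by
      obtain ⟨k, rfl⟩ := hev
      omega
    refine FullCycle.isGreatest_of_forall_ne
      ((FullCycle.mem_graphEigs_nm1CyclesAlt_iff (by omega) hev _).2
        (FullCycle.exists_nearFullSum_one (by omega)))
      ((FullCycle.mem_graphEigs_nm1CyclesAlt_iff (by omega) hev _).2
        (FullCycle.exists_nearFullSum_triple hn6))
      (Nat.cast_lt.2 (FullCycle.three_mul_factorial_lt hn)) fun μ hμ hne => ?_
    obtain ⟨φ, hφ, h⟩ := (FullCycle.mem_graphEigs_nm1CyclesAlt_iff (by omega) hev _).1 hμ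
    exact FullCycle.eigenvalue_le_of_ne_of_even hn.le hev hφ h hne
end
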